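/- arXiv:2501.04887 — 2 statements merged into one kernel-verified Lean document; each statement's English description precedes it below -/
import Mathlib

section
/- There exists a constant C > 0 depending only on P and Q such that for every admissible prime p and every pair (a,b) ∈ F_p^2, the number of tuples (y11,y12,y13,y14,y15,y16) ∈ F_p^6, avoiding all poles of P and Q, satisfying −P(y11)+P(y12)−P(y13)+P(y14)+P(y15)−P(y16) = a and −Q(y11)+Q(y12)−Q(y13)+Q(y14)+Q(y15)−Q(y16) = b, is at most C · p^4 (with C independent of a and b). -/
open scoped BigOperators ComplexOrder
open Polynomial

noncomputable section

namespace RatCorners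

/-- Reduction of a rational number modulo `p` (genuine when `p` does not divide the
denominator). -/
def ratRed (p : ℕ) (q : ℚ) : ZMod p := (q.num : ZMod p) * (q.den : ZMod p)⁻¹

/-- Coefficientwise reduction of a polynomial with rational coefficients modulo `p`. -/
def polyRed (p : ℕ) (f : Polynomial ℚ) : Polynomial (ZMod p) :=
  f.sum fun n a => Polynomial.C (ratRed p a) * Polynomial.X ^ n

/-- `p` divides no denominator of any coefficient of `P` (with numerator and denominator
of `P` in lowest terms). -/
def Admissible (p : ℕ) (P : RatFunc ℚ) : Prop :=
  (∀ n, ¬ p ∣ (P.num.coeff n).den) ∧ ∀ n, ¬ p ∣ (P.denom.coeff n).den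

/-- `y` is a pole of the reduction of `P` modulo `p`. -/
def IsPole (p : ℕ) (P : RatFunc ℚ) (y : ZMod p) : Prop :=
  (polyRed p P.denom).eval y = 0

instance (p : ℕ) (P : RatFunc ℚ) : DecidablePred (IsPole p P) := fun y =>
  inferInstanceAs (Decidable ((polyRed p P.denom).eval y = 0))

/-- Evaluation of the reduction of `P` modulo `p` at `y` (junk value `0` at poles). -/
def evalRed (p : ℕ) (P : RatFunc ℚ) (y : ZMod p) : ZMod p :=
  (polyRed p P.num).eval y * ((polyRed p P.denom).eval y)⁻¹

/-- A function is `1`-bounded if all its values have norm at most `1`. -/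
def OneBounded {α : Type*} (f : α → ℂ) : Prop := ∀ x, ‖f x‖ ≤ 1

/-- The formal derivative of a rational function. -/
def ratDeriv (P : RatFunc ℚ) : RatFunc ℚ :=
  algebraMap (Polynomial ℚ) (RatFunc ℚ)
      (Polynomial.derivative P.num * P.denom - P.num * Polynomial.derivative P.denom) /
    algebraMap (Polynomial ℚ) (RatFunc ℚ) (P.denom ^ 2)

/-- Substitution of the variable `y i` into a rational function `P ∈ ℚ(t)`, producing an
element of the rational function field `ℚ(y 0, …, y (n-1))`. -/
def substAt {n : ℕ} (P : RatFunc ℚ) (i : Fin n) : FractionRing (MvPolynomial (Fin n) ℚ) :=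
  Polynomial.eval₂
      ((algebraMap (MvPolynomial (Fin n) ℚ) (FractionRing (MvPolynomial (Fin n) ℚ))).comp
        MvPolynomial.C)
      (algebraMap (MvPolynomial (Fin n) ℚ) (FractionRing (MvPolynomial (Fin n) ℚ))
        (MvPolynomial.X i)) P.num /
    Polynomial.eval₂
      ((algebraMap (MvPolynomial (Fin n) ℚ) (FractionRing (MvPolynomial (Fin n) ℚ))).comp
        MvPolynomial.C)
      (algebraMap (MvPolynomial (Fin n) ℚ) (FractionRing (MvPolynomial (Fin n) ℚ))
        (MvPolynomial.X i)) P.denom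

variable (p : ℕ) [NeZero p]

/-- The counting operator `𝔼_{x₁,x₂,y} f₀(x₁,x₂) f₁(x₁+P(y),x₂) f₂(x₁,x₂+Q(y))`,
where the average in `y` avoids the poles of `P` and `Q` but is still normalized by `1/p`. -/
def cornerAvg (P Q : RatFunc ℚ) (f0 f1 f2 : ZMod p × ZMod p → ℂ) : ℂ :=
  (p : ℂ)⁻¹ ^ 3 * ∑ x1 : ZMod p, ∑ x2 : ZMod p, ∑ y : ZMod p,
    if ¬ IsPole p P y ∧ ¬ IsPole p Q y then
      f0 (x1, x2) * f1 (x1 + evalRed p P y, x2) * f2 (x1, x2 + evalRed p Q y)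
    else 0

/-- The main term `𝔼_{x₁,x₂} f₀(x₁,x₂) · 𝔼_a f₁(a,x₂) · 𝔼_b f₂(x₁,b)`. -/
def mainTerm (f0 f1 f2 : ZMod p × ZMod p → ℂ) : ℂ :=
  (p : ℂ)⁻¹ ^ 2 * ∑ x1 : ZMod p, ∑ x2 : ZMod p,
    f0 (x1, x2) * ((p : ℂ)⁻¹ * ∑ a : ZMod p, f1 (a, x2)) *
      ((p : ℂ)⁻¹ * ∑ b : ZMod p, f2 (x1, b))

/-- The `L^r` norm with respect to the uniform probability measure on `(ZMod p)²`. -/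
def Lnorm (r : ℝ) (f : ZMod p × ZMod p → ℂ) : ℝ :=
  ((p : ℝ)⁻¹ ^ 2 * ∑ x : ZMod p × ZMod p, ‖f x‖ ^ r) ^ r⁻¹

/-- The Gowers norm `‖f‖_{U²(0×F_p)}` along the second coordinate axis. -/
def U2vert (f : ZMod p × ZMod p → ℂ) : ℝ :=
  ((p : ℝ)⁻¹ ^ 4 * (∑ x : ZMod p × ZMod p, ∑ h : ZMod p, ∑ k : ZMod p,
      f x * (starRingEnd ℂ) (f (x + (0, h))) * (starRingEnd ℂ) (f (x + (0, k))) *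
        f (x + (0, h + k))).re) ^ ((4:ℝ)⁻¹)

/-- The Gowers norm `‖f‖_{U²(F_p×0)}` along the first coordinate axis. -/
def U2horiz (f : ZMod p × ZMod p → ℂ) : ℝ :=
  ((p : ℝ)⁻¹ ^ 4 * (∑ x : ZMod p × ZMod p, ∑ h : ZMod p, ∑ k : ZMod p,
      f x * (starRingEnd ℂ) (f (x + (h, 0))) * (starRingEnd ℂ) (f (x + (k, 0))) *
        f (x + (h + k, 0))).re) ^ ((4:ℝ)⁻¹)

/-- The additive character `e_p(x) = e^{2πix/p}` on `ZMod p`. -/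
def ep (x : ZMod p) : ℂ := Complex.exp (2 * Real.pi * Complex.I * (x.val : ℂ) / (p : ℂ))

/-- `e(r) = e^{2πir}` for a real number `r`. -/
def eC (r : ℝ) : ℂ := Complex.exp (2 * Real.pi * Complex.I * (r : ℂ))

/-- The Fourier transform `f̂(ξ) = 𝔼_x f(x) e_p(−x·ξ)` on `(ZMod p)²`. -/
def dft (f : ZMod p × ZMod p → ℂ) (ξ : ZMod p × ZMod p) : ℂ :=
  (p : ℂ)⁻¹ ^ 2 * ∑ x : ZMod p × ZMod p, f x * ep p (-(x.1 * ξ.1 + x.2 * ξ.2))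

/-- `F₁(n₁,𝐡) = ∑_{n₂} Δ_{−𝐡} f̂₁(n₁,n₂)` where `Δ_h g(x) = g(x)·conj g(x+h)`. -/
def F1 (f : ZMod p × ZMod p → ℂ) (n1 : ZMod p) (h : ZMod p × ZMod p) : ℂ :=
  ∑ n2 : ZMod p, dft p f (n1, n2) * (starRingEnd ℂ) (dft p f ((n1, n2) + -h))

/-- `F₂(m₂,𝐡) = ∑_{m₁} Δ_{𝐡} f̂₂(m₁,m₂)` where `Δ_h g(x) = g(x)·conj g(x+h)`. -/
def F2 (f : ZMod p × ZMod p → ℂ) (m2 : ZMod p) (h : ZMod p × ZMod p) : ℂ :=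
  ∑ m1 : ZMod p, dft p f (m1, m2) * (starRingEnd ℂ) (dft p f ((m1, m2) + h))

/-- The `F_p`-points of the Roth variety for corners associated to `P, Q`:
tuples `(y₁,…,y₁₆)` (indexed here by `0,…,15`) avoiding all poles of `P` and `Q` and
satisfying the ten defining equations. -/
def IsRothPoint (P Q : RatFunc ℚ) (y : Fin 16 → ZMod p) : Prop :=
  (∀ i, ¬ IsPole p P (y i)) ∧ (∀ i, ¬ IsPole p Q (y i)) ∧
  evalRed p P (y 0) - evalRed p P (y 2) - evalRed p P (y 8) + evalRed p P (y 10) = 0 ∧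
  evalRed p P (y 1) - evalRed p P (y 3) - evalRed p P (y 9) + evalRed p P (y 11) = 0 ∧
  evalRed p P (y 4) - evalRed p P (y 6) - evalRed p P (y 12) + evalRed p P (y 14) = 0 ∧
  evalRed p P (y 5) - evalRed p P (y 7) - evalRed p P (y 13) + evalRed p P (y 15) = 0 ∧
  evalRed p Q (y 0) - evalRed p Q (y 1) - evalRed p Q (y 8) + evalRed p Q (y 9) = 0 ∧
  evalRed p Q (y 2) - evalRed p Q (y 6) - evalRed p Q (y 10) + evalRed p Q (y 14) = 0 ∧
  evalRed p Q (y 3) - evalRed p Q (y 7) - evalRed p Q (y 11) + evalRed p Q (y 15) = 0 ∧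
  evalRed p Q (y 4) - evalRed p Q (y 5) - evalRed p Q (y 12) + evalRed p Q (y 13) = 0 ∧
  evalRed p P (y 8) - evalRed p P (y 9) - evalRed p P (y 10) + evalRed p P (y 11) -
      evalRed p P (y 12) + evalRed p P (y 13) + evalRed p P (y 14) - evalRed p P (y 15) = 0 ∧
  evalRed p Q (y 8) - evalRed p Q (y 9) - evalRed p Q (y 10) + evalRed p Q (y 11) -
      evalRed p Q (y 12) + evalRed p Q (y 13) + evalRed p Q (y 14) - evalRed p Q (y 15) = 0

/-- `|Y(F_p)|`, the number of `F_p`-points of the Roth variety for corners. -/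
def rothCard (P Q : RatFunc ℚ) : ℕ :=
  Nat.card {y : Fin 16 → ZMod p // IsRothPoint p P Q y}

/-- `χ` is an eigenfunction with respect to the first coordinate:
`χ(x₁,x₂) = 1_E(x₂) e_p(φ(x₂)x₁) e(ψ(x₂))`. -/
def IsEigen1 (χ : ZMod p × ZMod p → ℂ) : Prop :=
  ∃ (E : Finset (ZMod p)) (φ : ZMod p → ZMod p) (ψ : ZMod p → ℝ),
    ∀ x1 x2 : ZMod p,
      χ (x1, x2) = (if x2 ∈ E then 1 else 0) * ep p (φ x2 * x1) * eC (ψ x2)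

/-- `χ` is an eigenfunction with respect to the second coordinate:
`χ(x₁,x₂) = 1_E(x₁) e_p(φ(x₁)x₂) e(ψ(x₁))`. -/
def IsEigen2 (χ : ZMod p × ZMod p → ℂ) : Prop :=
  ∃ (E : Finset (ZMod p)) (φ : ZMod p → ZMod p) (ψ : ZMod p → ℝ),
    ∀ x1 x2 : ZMod p,
      χ (x1, x2) = (if x1 ∈ E then 1 else 0) * ep p (φ x1 * x2) * eC (ψ x1)

/-- The two-term counting operator `𝔼_{x₁,x₂,y} f₀(x₁,x₂) f₁(x₁+P(y),x₂)`. -/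
def twoAvg1 (P : RatFunc ℚ) (f0 f1 : ZMod p × ZMod p → ℂ) : ℂ :=
  (p : ℂ)⁻¹ ^ 3 * ∑ x1 : ZMod p, ∑ x2 : ZMod p, ∑ y : ZMod p,
    if ¬ IsPole p P y then f0 (x1, x2) * f1 (x1 + evalRed p P y, x2) else 0

/-- The two-term counting operator `𝔼_{x₁,x₂,y} f₀(x₁,x₂) f₁(x₁,x₂+P(y))`. -/
def twoAvg2 (P : RatFunc ℚ) (f0 f1 : ZMod p × ZMod p → ℂ) : ℂ :=
  (p : ℂ)⁻¹ ^ 3 * ∑ x1 : ZMod p, ∑ x2 : ZMod p, ∑ y : ZMod p,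
    if ¬ IsPole p P y then f0 (x1, x2) * f1 (x1, x2 + evalRed p P y) else 0

/-- Clearing denominators in an integral polynomial evaluated at fractions with a common
denominator. -/
theorem exists_homogenization {A σ : Type*} [CommRing A] (Φ : MvPolynomial σ ℤ)
    (a : σ → A) (d : A) :
    ∃ (n : ℕ) (Ψ : A), ∀ {F : Type} [Field F] (φ : A →+* F), φ d ≠ 0 →
      φ Ψ = φ d ^ n * MvPolynomial.aeval (fun i => φ (a i) / φ d) Φ := by
  induction Φ using MvPolynomial.induction_on with
  | C z => exact ⟨0, (z : A), fun φ _ => by simp⟩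
  | add f g hf hg =>
    obtain ⟨n, Ψ, hΨ⟩ := hf
    obtain ⟨m, Θ, hΘ⟩ := hg
    refine ⟨n + m, d ^ m * Ψ + d ^ n * Θ, fun φ hd => ?_⟩
    simp only [map_add, map_mul, map_pow, hΨ φ hd, hΘ φ hd]
    ring
  | mul_X f i hf =>
    obtain ⟨n, Ψ, hΨ⟩ := hf
    refine ⟨n + 1, Ψ * a i, fun φ hd => ?_⟩
    simp only [map_mul, hΨ φ hd, MvPolynomial.aeval_X]
    field_simp
    ring

theorem exists_derivation_extension {A K : Type*} [CommRing A] [IsDomain A] [Field K]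
    [Algebra A K] [IsFractionRing A K] (D₀ : Derivation ℤ A K) :
    ∃ D : Derivation ℤ K K, ∀ a, D (algebraMap A K a) = D₀ a := by
  let θ : A →+* TrivSqZeroExt K K :=
    { toFun := fun a => TrivSqZeroExt.inl (algebraMap A K a) + TrivSqZeroExt.inr (D₀ a)
      map_one' := by simp
      map_zero' := by simp
      map_add' := fun a b => by ext <;> simp
      map_mul' := fun a b => by
        ext
        · simp
        · simp only [TrivSqZeroExt.snd_add, TrivSqZeroExt.snd_inl, TrivSqZeroExt.snd_inr,
            TrivSqZeroExt.snd_mul, TrivSqZeroExt.fst_add, TrivSqZeroExt.fst_inl,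
            TrivSqZeroExt.fst_inr, Derivation.leibniz, Algebra.smul_def,
            MulOpposite.smul_eq_mul_unop, MulOpposite.unop_op, Algebra.algebraMap_self,
            RingHom.id_apply]
          ring }
  have hθ : ∀ a : nonZeroDivisors A, IsUnit (θ a) := fun a => by
    rw [TrivSqZeroExt.isUnit_iff_isUnit_fst]
    simp [θ]
  let Θ : K →+* TrivSqZeroExt K K := IsLocalization.lift hθ
  have hΘ : ∀ a, Θ (algebraMap A K a) = θ a := fun a => IsLocalization.lift_eq hθ a
  have hfst : ∀ z, (Θ z).fst = z := by
    have : (TrivSqZeroExt.fstHom K K K).toRingHom.comp Θ = RingHom.id K := by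
      apply IsLocalization.ringHom_ext (nonZeroDivisors A)
      ext a
      simp [hΘ, θ]
    exact fun z => DFunLike.congr_fun this z
  refine ⟨Derivation.mk'
    (((TrivSqZeroExt.sndHom K K).toAddMonoidHom.comp Θ.toAddMonoidHom).toIntLinearMap)
    fun a b => ?_, fun a => ?_⟩
  · change (Θ (a * b)).snd = a • (Θ b).snd + b • (Θ a).snd
    rw [map_mul, TrivSqZeroExt.snd_mul, hfst, hfst, op_smul_eq_smul]
  · change (Θ (algebraMap A K a)).snd = D₀ a
    rw [hΘ]
    simp [θ]

theorem derivation_aeval {σ K : Type*} [Fintype σ] [Field K] (D : Derivation ℤ K K) (w : σ → K)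
    (c : MvPolynomial σ ℤ) :
    D (MvPolynomial.aeval w c) =
      ∑ i, D (w i) * MvPolynomial.aeval w (MvPolynomial.pderiv i c) := by
  classical
  induction c using MvPolynomial.induction_on with
  | C z => simp
  | add f g hf hg => simp [hf, hg, mul_add, Finset.sum_add_distrib]
  | mul_X f j hf =>
    simp only [map_mul, Derivation.leibniz, hf, MvPolynomial.aeval_X, MvPolynomial.pderiv_X,
      smul_eq_mul, map_add, mul_add, Finset.sum_add_distrib, Finset.mul_sum]
    congr 1
    · rw [Finset.sum_eq_single j]
      · simp [mul_comm]
      · intro i _ hi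
        simp [Ne.symm hi]
      · simp
    · exact Finset.sum_congr rfl fun i _ => by ring

/-- The Jacobian criterion for algebraic independence. -/
theorem algebraicIndependent_of_det_ne_zero {σ K : Type*} [Fintype σ] [DecidableEq σ] [Field K]
    [CharZero K] (D : σ → Derivation ℤ K K) (w : σ → K)
    (hdet : (Matrix.of fun i j => D i (w j)).det ≠ 0) : AlgebraicIndependent ℤ w := by
  rw [algebraicIndependent_iff]
  suffices h : ∀ (n : ℕ) (c : MvPolynomial σ ℤ), (∀ m, c.coeff m ≠ 0 → m.degree < n) →
      MvPolynomial.aeval w c = 0 → c = 0 by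
    intro c hc
    refine h (c.totalDegree + 1) c (fun m hm => ?_) hc
    exact Nat.lt_succ_of_le (MvPolynomial.le_totalDegree (MvPolynomial.mem_support_iff.mpr hm))
  intro n
  induction n with
  | zero =>
    intro c hc _
    ext m
    by_contra hm
    exact absurd (hc m hm) (by simp)
  | succ n ih =>
    intro c hc h0
    have hv := Matrix.eq_zero_of_mulVec_eq_zero hdet
      (v := fun j => MvPolynomial.aeval w (MvPolynomial.pderiv j c)) (by
        ext i
        have := derivation_aeval (D i) w c
        rw [h0, map_zero] at this
        simpa [Matrix.mulVec, dotProduct] using this.symm)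
    have hp : ∀ j, MvPolynomial.pderiv j c = 0 := fun j => by
      refine ih _ (fun m hm => ?_) (congrFun hv j)
      rw [MvPolynomial.coeff_pderiv] at hm
      have := hc _ (left_ne_zero_of_mul hm)
      rw [map_add, Finsupp.degree_single] at this
      omega
    have hcoeff : ∀ m, m ≠ 0 → c.coeff m = 0 := fun m hm => by
      obtain ⟨j, hj⟩ := Finsupp.ne_iff.mp hm
      have hle : Finsupp.single j 1 ≤ m := by
        rw [Finsupp.single_le_iff]
        exact Nat.one_le_iff_ne_zero.mpr hj
      have := congrArg (MvPolynomial.coeff (m - Finsupp.single j 1)) (hp j)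
      rw [MvPolynomial.coeff_pderiv, tsub_add_cancel_of_le hle, MvPolynomial.coeff_zero] at this
      rcases mul_eq_zero.mp this with h | h
      · exact h
      · exact absurd h (by positivity)
    have hC : c = MvPolynomial.C (c.coeff 0) := by
      ext m
      rw [MvPolynomial.coeff_C]
      split_ifs with h
      · rw [h]
      · exact hcoeff m (Ne.symm h)
    rw [hC] at h0 ⊢
    rw [MvPolynomial.aeval_C, eq_intCast, Int.cast_eq_zero] at h0
    rw [h0, map_zero]

theorem exists_smul_eq_of_derivative_mul_eq {f g : ℤ[X]} (hg : g ≠ 0)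
    (h : derivative f * g = f * derivative g) : ∃ a b : ℤ, a ≠ 0 ∧ C a * f = C b * g := by
  by_cases hf : f = 0
  · exact ⟨1, 0, one_ne_zero, by simp [hf]⟩
  have key : ∀ f : ℤ[X], f ≠ 0 → derivative f * g = f * derivative g →
      f.natDegree = g.natDegree := by
    intro f hf h
    have hfl := leadingCoeff_ne_zero.mpr hf
    have hgl := leadingCoeff_ne_zero.mpr hg
    have h1 := congrArg (fun q => (X * q).coeff (f.natDegree + g.natDegree)) h
    have e1 : X * (derivative f * g) = (X * derivative f) * g := by ring
    have e2 : X * (f * derivative g) = f * (X * derivative g) := by ring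
    have d1 : ∀ q : ℤ[X], (X * derivative q).natDegree ≤ q.natDegree := fun q => by
      rw [natDegree_le_iff_coeff_eq_zero]
      intro N hN
      cases N with
      | zero => simp
      | succ N => simp [coeff_derivative, coeff_eq_zero_of_natDegree_lt hN]
    have c1 : ∀ q : ℤ[X], (X * derivative q).coeff q.natDegree = q.leadingCoeff * q.natDegree := by
      intro q
      rcases hq : q.natDegree with _ | N
      · simp
      · simp [coeff_derivative, leadingCoeff, hq]
    simp only [e1, e2] at h1
    rw [coeff_mul_add_eq_of_natDegree_le (d1 f) le_rfl,
      coeff_mul_add_eq_of_natDegree_le le_rfl (d1 g),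
      c1, c1] at h1
    have h2 : f.leadingCoeff * g.leadingCoeff * ((f.natDegree : ℤ) - g.natDegree) = 0 := by
      simp only [leadingCoeff] at h1 ⊢
      linear_combination h1
    have := (mul_eq_zero.mp h2).resolve_left (mul_ne_zero hfl hgl)
    omega
  refine ⟨g.leadingCoeff, f.leadingCoeff, leadingCoeff_ne_zero.mpr hg, ?_⟩
  by_contra hne
  set e := C g.leadingCoeff * f - C f.leadingCoeff * g with he
  have he0 : e ≠ 0 := sub_ne_zero.mpr hne
  have hed : e.natDegree = g.natDegree := by
    refine key e he0 ?_
    simp only [he, derivative_sub, derivative_mul, derivative_C]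
    linear_combination C g.leadingCoeff * h
  have hfg := key f hf h
  apply leadingCoeff_ne_zero.mpr he0
  rw [leadingCoeff, hed, he, coeff_sub, coeff_C_mul, coeff_C_mul]
  simp only [leadingCoeff, hfg]
  ring

theorem aeval_cons_eq_eval₂_finSuccEquiv {F : Type*} [CommRing F] {n : ℕ} (y : F)
    (s : Fin n → F) (f : MvPolynomial (Fin (n + 1)) ℤ) :
    MvPolynomial.aeval (Fin.cons y s : Fin (n + 1) → F) f =
      ((MvPolynomial.finSuccEquiv ℤ n f).map (MvPolynomial.aeval s).toRingHom).eval y := by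
  rw [eval_map]
  induction f using MvPolynomial.induction_on with
  | C z => simp [-eq_intCast, MvPolynomial.finSuccEquiv_apply]
  | add f g hf hg => simp only [map_add, eval₂_add, hf, hg]
  | mul_X f i hf =>
    simp only [map_mul, eval₂_mul, hf]
    refine Fin.cases ?_ (fun j => ?_) i
    · simp [MvPolynomial.finSuccEquiv_X_zero]
    · simp [MvPolynomial.finSuccEquiv_X_succ]

/-- The sum `A(s₀)/B(s₀) + A(s₁)/B(s₁)`. -/
def fracSum {F : Type*} [Field F] (A B : ℤ[X]) (s : Fin 2 → F) : F :=
  aeval (s 0) A / aeval (s 0) B + aeval (s 1) A / aeval (s 1) B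

/-- Neither denominator vanishes at either coordinate of `s`. -/
def Regular {F : Type*} [Field F] (B H : ℤ[X]) (s : Fin 2 → F) : Prop :=
  ∀ i, aeval (s i) B ≠ 0 ∧ aeval (s i) H ≠ 0

theorem exists_common_denominator (A B G H : ℤ[X]) :
    ∃ (a : Fin 3 → MvPolynomial (Fin 2) ℤ) (d : MvPolynomial (Fin 2) ℤ),
      ∀ {F : Type} [Field F] (s : Fin 2 → F), Regular B H s →
        MvPolynomial.aeval s d ≠ 0 ∧
        (fun i => MvPolynomial.aeval s (a i) / MvPolynomial.aeval s d) =
          (Fin.cons (s 0) ![fracSum A B s, fracSum G H s] : Fin 3 → F) := by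
  let polyAt : Fin 2 → ℤ[X] → MvPolynomial (Fin 2) ℤ := fun i f => aeval (MvPolynomial.X i) f
  refine ⟨![MvPolynomial.X 0 * (polyAt 0 B * polyAt 1 B * polyAt 0 H * polyAt 1 H),
      (polyAt 0 A * polyAt 1 B + polyAt 1 A * polyAt 0 B) * polyAt 0 H * polyAt 1 H,
      (polyAt 0 G * polyAt 1 H + polyAt 1 G * polyAt 0 H) * polyAt 0 B * polyAt 1 B],
    polyAt 0 B * polyAt 1 B * polyAt 0 H * polyAt 1 H, fun s hs => ?_⟩
  have hat : ∀ i f, MvPolynomial.aeval s (polyAt i f) = aeval (s i) f := fun i f => by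
    simp only [polyAt, ← aeval_algHom_apply, MvPolynomial.aeval_X]
  obtain ⟨h0, h0'⟩ := hs 0
  obtain ⟨h1, h1'⟩ := hs 1
  refine ⟨by simp [hat, h0, h0', h1, h1'], ?_⟩
  ext i
  fin_cases i
  · simp [hat, h0, h0', h1, h1']
  · simp [hat, fracSum]
    field_simp
  · simp [hat, fracSum]
    field_simp

/-- The generic point of the plane. -/
def genericPoint (K : Type*) [Field K] [Algebra (MvPolynomial (Fin 2) ℤ) K]
    (i : Fin 2) : K :=
  algebraMap (MvPolynomial (Fin 2) ℤ) K (MvPolynomial.X i)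

theorem aeval_genericPoint (K : Type*) [Field K]
    [Algebra (MvPolynomial (Fin 2) ℤ) K] (f : MvPolynomial (Fin 2) ℤ) :
    MvPolynomial.aeval (genericPoint K) f = algebraMap _ K f := by
  have : (MvPolynomial.aeval (genericPoint K) : _ →ₐ[ℤ] K) =
      IsScalarTower.toAlgHom ℤ (MvPolynomial (Fin 2) ℤ) K := by
    ext i
    simp [genericPoint]
  exact DFunLike.congr_fun this f

theorem aeval_X_injective (i : Fin 2) :
    Function.Injective (aeval (MvPolynomial.X i : MvPolynomial (Fin 2) ℤ) : ℤ[X] → _) := by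
  intro f g h
  have := congrArg (MvPolynomial.aeval (fun _ => (X : ℤ[X]))) h
  simpa [← aeval_algHom_apply] using this

theorem aeval_genericPoint_eq (K : Type*) [Field K]
    [Algebra (MvPolynomial (Fin 2) ℤ) K] (i : Fin 2) (f : ℤ[X]) :
    aeval (genericPoint K i) f =
      algebraMap (MvPolynomial (Fin 2) ℤ) K (aeval (MvPolynomial.X i) f) :=
  aeval_algebraMap_apply _ _ _

theorem aeval_genericPoint_ne_zero (K : Type*) [Field K]
    [Algebra (MvPolynomial (Fin 2) ℤ) K] [IsFractionRing (MvPolynomial (Fin 2) ℤ) K] (i : Fin 2)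
    {f : ℤ[X]} (hf : f ≠ 0) : aeval (genericPoint K i) f ≠ 0 := by
  rw [aeval_genericPoint_eq, Ne, IsFractionRing.to_map_eq_zero_iff]
  intro h
  exact hf (aeval_X_injective i (by simpa using h))

theorem not_algebraicIndependent_three {K : Type*} [Field K]
    [Algebra (MvPolynomial (Fin 2) ℤ) K] [IsFractionRing (MvPolynomial (Fin 2) ℤ) K]
    (x : Fin 3 → K) : ¬ AlgebraicIndependent ℤ x := by
  intro h
  have : Algebra.IsAlgebraic (MvPolynomial (Fin 2) ℤ) K :=
    IsLocalization.isAlgebraic _ (nonZeroDivisors (MvPolynomial (Fin 2) ℤ))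
  have : FaithfulSMul (MvPolynomial (Fin 2) ℤ) K :=
    (faithfulSMul_iff_algebraMap_injective _ _).mpr (IsFractionRing.injective _ _)
  have h1 := h.lift_cardinalMk_le_trdeg
  have h2 : IsTranscendenceBasis ℤ
      (algebraMap (MvPolynomial (Fin 2) ℤ) K ∘ MvPolynomial.X) :=
    (IsTranscendenceBasis.mvPolynomial (Fin 2) ℤ).algebraMap_comp
  rw [← h2.lift_cardinalMk_eq_trdeg] at h1
  simp at h1
  norm_num at h1

theorem algebraicIndependent_fracSum (K : Type*) [Field K]
    [Algebra (MvPolynomial (Fin 2) ℤ) K] [IsFractionRing (MvPolynomial (Fin 2) ℤ) K]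
    {A B G H : ℤ[X]} (hB : B ≠ 0) (hH : H ≠ 0)
    (hind : ∀ α β γ : ℤ, C α * A * H + C β * G * B + C γ * B * H = 0 → α = 0 ∧ β = 0) :
    AlgebraicIndependent ℤ ![fracSum A B (genericPoint K), fracSum G H (genericPoint K)] := by
  have hD : ∀ i : Fin 2, ∃ D : Derivation ℤ K K,
      ∀ j, D (genericPoint K j) = if i = j then 1 else 0 := fun i => by
    obtain ⟨D, hD⟩ := exists_derivation_extension (K := K)
      ((Algebra.linearMap (MvPolynomial (Fin 2) ℤ) K).compDer (MvPolynomial.pderiv i))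
    refine ⟨D, fun j => ?_⟩
    rw [genericPoint, hD]
    change algebraMap _ K (MvPolynomial.pderiv i (MvPolynomial.X j)) = _
    rw [MvPolynomial.pderiv_X, Pi.single_apply, apply_ite (algebraMap _ K), map_one, map_zero]
    simp only [eq_comm]
  choose D hD using hD
  have hDa : ∀ (i j : Fin 2) (f : ℤ[X]), D i (aeval (genericPoint K j) f) =
      if i = j then aeval (genericPoint K j) (derivative f) else 0 := fun i j f => by
    rw [Derivation.map_aeval, hD]
    split_ifs <;> simp
  have hDf : ∀ (i : Fin 2) (f g : ℤ[X]), D i (fracSum f g (genericPoint K)) =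
      aeval (genericPoint K i) (derivative f * g - f * derivative g) /
        aeval (genericPoint K i) g ^ 2 := fun i f g => by
    simp only [fracSum, map_add, Derivation.leibniz_div, hDa, smul_eq_mul]
    fin_cases i <;> simp <;> ring
  have : CharZero K :=
    charZero_of_injective_algebraMap (IsFractionRing.injective (MvPolynomial (Fin 2) ℤ) K)
  refine algebraicIndependent_of_det_ne_zero D _ fun hdet => ?_
  rw [Matrix.det_fin_two] at hdet
  simp only [Matrix.of_apply, Matrix.cons_val_zero, Matrix.cons_val_one, hDf] at hdet
  set r := (derivative A * B - A * derivative B) * H ^ 2 with hr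
  set s := (derivative G * H - G * derivative H) * B ^ 2 with hs
  have hB0 := aeval_genericPoint_ne_zero K 0 hB
  have hB1 := aeval_genericPoint_ne_zero K 1 hB
  have hH0 := aeval_genericPoint_ne_zero K 0 hH
  have hH1 := aeval_genericPoint_ne_zero K 1 hH
  have hrs : aeval (genericPoint K 0) r * aeval (genericPoint K 1) s =
      aeval (genericPoint K 1) r * aeval (genericPoint K 0) s := by
    field_simp at hdet
    simp only [hr, hs, map_mul, map_pow]
    linear_combination hdet
  have hrs' : (aeval (MvPolynomial.X 0) r * aeval (MvPolynomial.X 1) s :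
      MvPolynomial (Fin 2) ℤ) = aeval (MvPolynomial.X 1) r * aeval (MvPolynomial.X 0) s := by
    apply IsFractionRing.injective (MvPolynomial (Fin 2) ℤ) K
    simpa only [map_mul, aeval_genericPoint_eq] using hrs
  have hev : ∀ z : ℤ, r * C (s.eval z) = C (r.eval z) * s := fun z => by
    have := congrArg (MvPolynomial.aeval ![X, C z]) hrs'
    have hC : ∀ f : ℤ[X], aeval (z : ℤ[X]) f = ((f.eval z : ℤ) : ℤ[X]) := fun f => by
      simpa using aeval_algHom_apply (Algebra.ofId ℤ ℤ[X]) z f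
    simpa [← aeval_algHom_apply, hC] using this
  have hprop : ∃ α β : ℤ, (α ≠ 0 ∨ β ≠ 0) ∧ C α * r = C β * s := by
    by_cases hs0 : s = 0
    · exact ⟨0, 1, by simp, by simp [hs0]⟩
    obtain ⟨z, hz⟩ : ∃ z : ℤ, s.eval z ≠ 0 := by
      by_contra! h
      exact hs0 (Polynomial.funext fun z => by simpa using h z)
    exact ⟨s.eval z, r.eval z, Or.inl hz, by rw [mul_comm, hev]⟩
  obtain ⟨α, β, hαβ, h⟩ := hprop
  obtain ⟨a, b, ha, hab⟩ := exists_smul_eq_of_derivative_mul_eq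
    (f := C α * A * H - C β * G * B) (g := B * H) (mul_ne_zero hB hH) (by
      simp only [derivative_sub, derivative_mul, derivative_C]
      rw [hr, hs] at h
      linear_combination h)
  obtain ⟨h1, h2⟩ := hind (a * α) (-(a * β)) (-b) (by
    simp only [map_mul, map_neg]
    linear_combination hab)
  simp [ha] at h1 h2
  simp [h1, h2] at hαβ

/-- A polynomial relation between a coordinate `x` and the sums `u = A(x)/B(x) + A(y)/B(y)`,
`v = G(x)/H(x) + G(y)/H(y)`, valid over every field, with leading coefficient in `x` generically
nonzero. -/
theorem exists_relation (K : Type) [Field K] [Algebra (MvPolynomial (Fin 2) ℤ) K]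
    [IsFractionRing (MvPolynomial (Fin 2) ℤ) K] {A B G H : ℤ[X]} (hB : B ≠ 0) (hH : H ≠ 0)
    (hind : ∀ α β γ : ℤ, C α * A * H + C β * G * B + C γ * B * H = 0 → α = 0 ∧ β = 0) :
    ∃ (Φ : (MvPolynomial (Fin 2) ℤ)[X]) (Ψ : MvPolynomial (Fin 2) ℤ), Ψ ≠ 0 ∧
      ∀ {F : Type} [Field F] (s : Fin 2 → F), Regular B H s →
        (Φ.map (MvPolynomial.aeval ![fracSum A B s, fracSum G H s]).toRingHom).eval (s 0) = 0 ∧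
        (MvPolynomial.aeval ![fracSum A B s, fracSum G H s] Φ.leadingCoeff = 0 →
          MvPolynomial.aeval s Ψ = 0) := by
  have hreg : Regular B H (genericPoint K) := fun i =>
    ⟨aeval_genericPoint_ne_zero K i hB, aeval_genericPoint_ne_zero K i hH⟩
  have hw := algebraicIndependent_fracSum K hB hH hind
  set w := ![fracSum A B (genericPoint K), fracSum G H (genericPoint K)] with hwdef
  have hdep := not_algebraicIndependent_three (Fin.cons (genericPoint K 0) w : Fin 3 → K)
  rw [algebraicIndependent_iff] at hdep
  push Not at hdep
  obtain ⟨f, hf, hf0⟩ := hdep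
  have hzero : ∀ g : MvPolynomial (Fin 2) ℤ, MvPolynomial.aeval (genericPoint K) g = 0 ↔ g = 0 :=
    fun g => by rw [aeval_genericPoint, IsFractionRing.to_map_eq_zero_iff]
  obtain ⟨a, d, had⟩ := exists_common_denominator A B G H
  have had' : ∀ {F : Type} [Field F] (s : Fin 2 → F), Regular B H s →
      (fun i => MvPolynomial.aeval s (Fin.tail a i) / MvPolynomial.aeval s d) =
        ![fracSum A B s, fracSum G H s] := fun s hs =>
    congrArg Fin.tail (had s hs).2
  obtain ⟨n, Θ, hΘ⟩ := exists_homogenization f a d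
  obtain ⟨m, Ψ, hΨ⟩ := exists_homogenization (MvPolynomial.finSuccEquiv ℤ 2 f).leadingCoeff
    (Fin.tail a) d
  have hΘ0 : Θ = 0 := by
    rw [← hzero]
    have := hΘ (MvPolynomial.aeval (genericPoint K)).toRingHom (had _ hreg).1
    simp only [AlgHom.toRingHom_eq_coe, RingHom.coe_coe, (had _ hreg).2] at this
    rw [this, ← hwdef, hf, mul_zero]
  have hΨw := hΨ (MvPolynomial.aeval (genericPoint K)).toRingHom (had _ hreg).1
  refine ⟨MvPolynomial.finSuccEquiv ℤ 2 f, Ψ, ?_, fun s hs => ⟨?_, fun h => ?_⟩⟩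
  · rw [Ne, ← hzero]
    simp only [AlgHom.toRingHom_eq_coe, RingHom.coe_coe, had' _ hreg] at hΨw
    rw [hΨw]
    refine mul_ne_zero (pow_ne_zero _ (had _ hreg).1) ?_
    rw [algebraicIndependent_iff] at hw
    intro h
    have := hw _ h
    simp [hf0] at this
  · rw [← aeval_cons_eq_eval₂_finSuccEquiv, ← (had s hs).2]
    have := hΘ (MvPolynomial.aeval s).toRingHom (had s hs).1
    rw [hΘ0, map_zero, eq_comm] at this
    exact (mul_eq_zero.mp this).resolve_left (pow_ne_zero _ (had s hs).1)
  · have := hΨ (MvPolynomial.aeval s).toRingHom (had s hs).1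
    simp only [AlgHom.toRingHom_eq_coe, RingHom.coe_coe, had' s hs] at this
    rw [this, h, mul_zero]

theorem exists_map_ne_zero {σ : Type*} {Ψ : MvPolynomial σ ℤ} (hΨ : Ψ ≠ 0) :
    ∃ N : ℤ, N ≠ 0 ∧ ∀ p : ℕ, ¬ (p : ℤ) ∣ N →
      MvPolynomial.map (Int.castRingHom (ZMod p)) Ψ ≠ 0 := by
  obtain ⟨m, hm⟩ := MvPolynomial.ne_zero_iff.mp hΨ
  refine ⟨Ψ.coeff m, hm, fun p hp h => hp ?_⟩
  have := congrArg (MvPolynomial.coeff m) h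
  rw [MvPolynomial.coeff_map] at this
  exact (ZMod.intCast_zmod_eq_zero_iff_dvd _ _).mp (by simpa using this)

theorem card_zeros_le {p : ℕ} [Fact p.Prime] {f : MvPolynomial (Fin 2) (ZMod p)} (hf : f ≠ 0) :
    (Finset.univ.filter fun s => MvPolynomial.eval s f = 0).card ≤ f.totalDegree * p := by
  have h := MvPolynomial.schwartz_zippel_totalDegree hf Finset.univ
  have hp : (0 : ℚ≥0) < p := by exact_mod_cast (Fact.out : p.Prime).pos
  rw [Fintype.piFinset_univ, Finset.card_univ, ZMod.card, div_le_div_iff₀ (by positivity) hp] at h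
  have h' : ((Finset.univ.filter fun s => MvPolynomial.eval s f = 0).card : ℚ≥0) * p ≤
      (f.totalDegree * p) * p := by
    calc _ ≤ _ := h
      _ = _ := by ring
  exact_mod_cast le_of_mul_le_mul_right h' hp

/-- Outside a set of `O(p)` points, the fibres of `(x, y) ↦ (u, v)` are bounded. -/
theorem exists_fibre_bound {A B G H : ℤ[X]} (hB : B ≠ 0) (hH : H ≠ 0)
    (hind : ∀ α β γ : ℤ, C α * A * H + C β * G * B + C γ * B * H = 0 → α = 0 ∧ β = 0) :
    ∃ (k M : ℕ) (N : ℤ), N ≠ 0 ∧ ∀ (p : ℕ) [Fact p.Prime], ¬ (p : ℤ) ∣ N →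
      ∃ T : Finset (Fin 2 → ZMod p), T.card ≤ M * p ∧ ∀ s ∉ T, Regular B H s →
        ∃ R : Finset (Fin 2 → ZMod p), R.card ≤ k ∧ ∀ t, Regular B H t →
          fracSum A B t = fracSum A B s → fracSum G H t = fracSum G H s → t ∈ R := by
  classical
  obtain ⟨Φ, Ψ, hΨ, hrel⟩ :=
    exists_relation (FractionRing (MvPolynomial (Fin 2) ℤ)) hB hH hind
  obtain ⟨N, hN, hmap⟩ := exists_map_ne_zero hΨ
  refine ⟨Φ.natDegree ^ 2, Ψ.totalDegree, N, hN, fun p _ hp =>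
    ⟨Finset.univ.filter fun s => MvPolynomial.eval s (Ψ.map (Int.castRingHom _)) = 0,
      (card_zeros_le (hmap p hp)).trans
        (Nat.mul_le_mul_right _ (Finset.sup_mono (MvPolynomial.support_map_subset _ _))),
      fun s hs hsreg => ?_⟩⟩
  set q := Φ.map (MvPolynomial.aeval ![fracSum A B s, fracSum G H s]).toRingHom with hq
  have hq0 : q ≠ 0 := by
    intro h0
    have h1 := congrArg (fun q => q.coeff Φ.natDegree) h0
    simp only [hq, coeff_map, coeff_zero] at h1
    have h2 := (hrel s hsreg).2 h1
    apply hs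
    rw [Finset.mem_filter, MvPolynomial.eval_map]
    refine ⟨Finset.mem_univ _, ?_⟩
    rw [← h2, MvPolynomial.aeval_def]
    rfl
  refine ⟨Fintype.piFinset fun _ => q.roots.toFinset, ?_, fun t ht hu hv => ?_⟩
  · rw [Fintype.card_piFinset_const]
    exact Nat.pow_le_pow_left ((Multiset.toFinset_card_le _).trans
      ((card_roots' q).trans natDegree_map_le)) 2
  · have hroot : ∀ t : Fin 2 → ZMod p, Regular B H t → fracSum A B t = fracSum A B s →
        fracSum G H t = fracSum G H s → t 0 ∈ q.roots.toFinset := fun t ht hu hv => by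
      rw [Multiset.mem_toFinset, mem_roots hq0, IsRoot.def, hq, ← hu, ← hv]
      exact (hrel t ht).1
    rw [Fintype.mem_piFinset, Fin.forall_fin_two]
    refine ⟨hroot t ht hu hv, hroot (t ∘ Equiv.swap 0 1) (fun i => ht _) ?_ ?_⟩
    · rw [← hu]
      simp [fracSum, add_comm]
    · rw [← hv]
      simp [fracSum, add_comm]

/-- Counting solutions of `g s = g t + δ` when the fibres of `g` are bounded outside `T`. -/
theorem card_pairs_le {S V : Type*} [DecidableEq S] [DecidableEq V] [AddGroup V] (U T : Finset S)
    (g : S → V) (k : ℕ) (hfib : ∀ s ∈ U, s ∉ T → (U.filter fun t => g t = g s).card ≤ k) (δ : V) :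
    ((U ×ˢ U).filter fun st => g st.1 = g st.2 + δ).card ≤ 2 * k * U.card + T.card ^ 2 := by
  have hone : ∀ v : V, ((U \ T).filter fun s => g s = v).card ≤ k := fun v => by
    rcases ((U \ T).filter fun s => g s = v).eq_empty_or_nonempty with h | ⟨s, hs⟩
    · simp [h]
    · simp only [Finset.mem_filter, Finset.mem_sdiff] at hs
      refine le_trans (Finset.card_le_card ?_) (hfib s hs.1.1 hs.1.2)
      rw [hs.2]
      exact Finset.filter_subset_filter _ Finset.sdiff_subset
  have h1 : (((U \ T) ×ˢ U).filter fun st => g st.1 = g st.2 + δ).card ≤ k * U.card := by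
    refine Finset.card_le_mul_card_image_of_maps_to (f := Prod.snd) ?_ k fun t _ => ?_
    · simp only [Finset.mem_filter, Finset.mem_product]
      exact fun x hx => hx.1.2
    · refine le_trans (Finset.card_le_card_of_injOn Prod.fst ?_ ?_) (hone (g t + δ))
      · rintro ⟨x, y⟩ h
        simp only [Finset.coe_filter, Finset.mem_filter, Finset.mem_product, Set.mem_ofPred_eq,
          Finset.mem_sdiff] at h ⊢
        obtain ⟨⟨h, h'⟩, rfl⟩ := h
        exact ⟨h.1, h'⟩
      · rintro ⟨x, y⟩ h ⟨x', y'⟩ h' e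
        simp only [Finset.coe_filter, Set.mem_ofPred_eq] at h h' e
        rw [Prod.mk.injEq]
        exact ⟨e, h.2.trans h'.2.symm⟩
  have h2 : ((U ×ˢ (U \ T)).filter fun st => g st.1 = g st.2 + δ).card ≤ k * U.card := by
    refine Finset.card_le_mul_card_image_of_maps_to (f := Prod.fst) ?_ k fun t _ => ?_
    · simp only [Finset.mem_filter, Finset.mem_product]
      exact fun x hx => hx.1.1
    · refine le_trans (Finset.card_le_card_of_injOn Prod.snd ?_ ?_) (hone (g t - δ))
      · rintro ⟨x, y⟩ h
        simp only [Finset.coe_filter, Finset.mem_filter, Finset.mem_product, Set.mem_ofPred_eq,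
          Finset.mem_sdiff] at h ⊢
        obtain ⟨⟨h, h'⟩, rfl⟩ := h
        exact ⟨h.2, by rw [h', add_sub_cancel_right]⟩
      · rintro ⟨x, y⟩ h ⟨x', y'⟩ h' e
        simp only [Finset.coe_filter, Set.mem_ofPred_eq] at h h' e
        rw [Prod.mk.injEq]
        exact ⟨h.2.trans h'.2.symm, e⟩
  have hsub : ((U ×ˢ U).filter fun st => g st.1 = g st.2 + δ) ⊆
      (((U \ T) ×ˢ U).filter fun st => g st.1 = g st.2 + δ) ∪
        (((U ×ˢ (U \ T)).filter fun st => g st.1 = g st.2 + δ) ∪ T ×ˢ T) := by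
    intro x
    simp only [Finset.mem_filter, Finset.mem_product, Finset.mem_union, Finset.mem_sdiff]
    tauto
  calc _ ≤ _ := Finset.card_le_card hsub
    _ ≤ _ := Finset.card_union_le _ _
    _ ≤ k * U.card + (k * U.card + T.card ^ 2) := by
      refine add_le_add h1 ((Finset.card_union_le _ _).trans (add_le_add h2 ?_))
      rw [Finset.card_product, sq]
    _ = _ := by ring

theorem intCast_mul_ratRed {p : ℕ} [Fact p.Prime] {q : ℚ} {z N : ℤ} (hp : ¬ (p : ℤ) ∣ N)
    (h : (z : ℚ) = N * q) : (N : ZMod p) * ratRed p q = z := by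
  have hden : (q.den : ℚ) ≠ 0 := by exact_mod_cast q.den_nz
  have h1 : z * q.den = N * q.num := by
    have : (z : ℚ) * q.den = N * q.num := by rw [h, mul_assoc, Rat.mul_den_eq_num]
    exact_mod_cast this
  have h2 : (q.den : ZMod p) ≠ 0 := by
    rw [Ne, ZMod.natCast_eq_zero_iff]
    intro hdvd
    have hcop : IsCoprime (q.den : ℤ) q.num :=
      (Int.isCoprime_iff_gcd_eq_one.mpr (by simpa [Int.gcd] using q.reduced)).symm
    exact hp ((Int.natCast_dvd_natCast.mpr hdvd).trans
      (hcop.dvd_of_dvd_mul_right ⟨z, by rw [← h1, mul_comm]⟩))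
  have h3 : (z : ZMod p) * q.den = N * q.num := by
    exact_mod_cast congrArg (Int.cast (R := ZMod p)) h1
  rw [ratRed, ← mul_assoc, ← h3, mul_inv_cancel_right₀ h2]

theorem C_mul_polyRed {p : ℕ} [Fact p.Prime] {f : ℚ[X]} {g : ℤ[X]} {N : ℤ} (hp : ¬ (p : ℤ) ∣ N)
    (h : g.map (Int.castRingHom ℚ) = C (N : ℚ) * f) :
    C (N : ZMod p) * polyRed p f = g.map (Int.castRingHom (ZMod p)) := by
  have hcoeff : ∀ n, (polyRed p f).coeff n = ratRed p (f.coeff n) := fun n => by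
    rw [polyRed, Polynomial.sum, finsetSum_coeff]
    simp only [coeff_C_mul_X_pow]
    rw [Finset.sum_ite_eq]
    split_ifs with hn
    · rfl
    · simp [notMem_support_iff.mp hn, ratRed]
  ext n
  have hn := congrArg (fun f => f.coeff n) h
  simp only [coeff_map, coeff_C_mul, eq_intCast] at hn
  rw [coeff_C_mul, hcoeff, intCast_mul_ratRed hp hn, coeff_map, eq_intCast]

/-- Numerator and denominator of `P`, scaled to have integral coefficients. -/
theorem exists_int_model (P : RatFunc ℚ) :
    ∃ (A B : ℤ[X]) (N : ℤ), N ≠ 0 ∧ A.map (Int.castRingHom ℚ) = C (N : ℚ) * P.num ∧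
      B.map (Int.castRingHom ℚ) = C (N : ℚ) * P.denom := by
  have key : ∀ f : ℚ[X], ∃ (g : ℤ[X]) (N : ℤ), N ≠ 0 ∧
      g.map (Int.castRingHom ℚ) = C (N : ℚ) * f := fun f => by
    obtain ⟨b, hb, h⟩ := IsLocalization.integerNormalization_spec (nonZeroDivisors ℤ) f
    refine ⟨IsLocalization.integerNormalization (nonZeroDivisors ℤ) f, b,
      nonZeroDivisors.ne_zero hb, ?_⟩
    rw [← smul_eq_C_mul, Int.cast_smul_eq_zsmul]
    exact h
  obtain ⟨A, M, hM, hA⟩ := key P.num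
  obtain ⟨B, N, hN, hB⟩ := key P.denom
  refine ⟨C N * A, C M * B, M * N, mul_ne_zero hM hN, ?_, ?_⟩
  · simp [hA]; ring
  · simp [hB]; ring

section IntModel

variable {P : RatFunc ℚ} {A B : ℤ[X]} {N : ℤ}

theorem eval_polyRed {q : ℕ} [Fact q.Prime] {f : ℚ[X]} {g : ℤ[X]} (hq : ¬ (q : ℤ) ∣ N)
    (h : g.map (Int.castRingHom ℚ) = C (N : ℚ) * f) (y : ZMod q) :
    aeval y g = (N : ZMod q) * (polyRed q f).eval y := by
  rw [← eval_C_mul, C_mul_polyRed hq h, eval_map, aeval_def]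
  rfl

theorem isPole_iff {q : ℕ} [Fact q.Prime] (hq : ¬ (q : ℤ) ∣ N)
    (hB : B.map (Int.castRingHom ℚ) = C (N : ℚ) * P.denom) (y : ZMod q) :
    IsPole q P y ↔ aeval y B = 0 := by
  have hN : (N : ZMod q) ≠ 0 := by rwa [Ne, ZMod.intCast_zmod_eq_zero_iff_dvd]
  rw [IsPole, eval_polyRed hq hB, mul_eq_zero, or_iff_right hN]

theorem evalRed_eq_div {q : ℕ} [Fact q.Prime] (hq : ¬ (q : ℤ) ∣ N)
    (hA : A.map (Int.castRingHom ℚ) = C (N : ℚ) * P.num)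
    (hB : B.map (Int.castRingHom ℚ) = C (N : ℚ) * P.denom) (y : ZMod q) :
    evalRed q P y = aeval y A / aeval y B := by
  have hN : (N : ZMod q) ≠ 0 := by rwa [Ne, ZMod.intCast_zmod_eq_zero_iff_dvd]
  rw [evalRed, eval_polyRed hq hA, eval_polyRed hq hB, mul_div_mul_left _ _ hN, div_eq_mul_inv]

theorem ne_zero_of_map_eq_denom (hN : N ≠ 0)
    (hB : B.map (Int.castRingHom ℚ) = C (N : ℚ) * P.denom) : B ≠ 0 := by
  rintro rfl
  rw [Polynomial.map_zero, eq_comm, mul_eq_zero, C_eq_zero, Int.cast_eq_zero] at hB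
  exact hB.elim hN P.denom_ne_zero

/-- The embedding `ℤ[t] → ℚ(t)`. -/
def toRatFunc : ℤ[X] →+* RatFunc ℚ :=
  (algebraMap ℚ[X] (RatFunc ℚ)).comp (mapRingHom (Int.castRingHom ℚ))

theorem toRatFunc_ne_zero {f : ℤ[X]} (hf : f ≠ 0) : toRatFunc f ≠ 0 := by
  rw [toRatFunc, RingHom.comp_apply, Ne, IsFractionRing.to_map_eq_zero_iff]
  exact (Polynomial.map_ne_zero_iff Int.cast_injective).mpr hf

theorem eq_toRatFunc_div (hN : N ≠ 0) (hA : A.map (Int.castRingHom ℚ) = C (N : ℚ) * P.num)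
    (hB : B.map (Int.castRingHom ℚ) = C (N : ℚ) * P.denom) :
    P = toRatFunc A / toRatFunc B := by
  have hN' : algebraMap ℚ[X] (RatFunc ℚ) (C (N : ℚ)) ≠ 0 := by
    simpa only [Ne, IsFractionRing.to_map_eq_zero_iff, C_eq_zero, Int.cast_eq_zero] using hN
  simp only [toRatFunc, RingHom.comp_apply, coe_mapRingHom, hA, hB, map_mul]
  rw [mul_div_mul_left _ _ hN', RatFunc.num_div_denom]

end IntModel

theorem eq_zero_of_linearIndependent {P Q : RatFunc ℚ}
    (hPQ : LinearIndependent ℚ ![P, Q, (1 : RatFunc ℚ)]) {A B G H : ℤ[X]} (hB : B ≠ 0)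
    (hH : H ≠ 0) (hP : P = toRatFunc A / toRatFunc B) (hQ : Q = toRatFunc G / toRatFunc H)
    (α β γ : ℤ) (h : C α * A * H + C β * G * B + C γ * B * H = 0) : α = 0 ∧ β = 0 := by
  have hB' := toRatFunc_ne_zero hB
  have hH' := toRatFunc_ne_zero hH
  have hC : ∀ z : ℤ, toRatFunc (C z) = z := fun z => by
    rw [← map_intCast toRatFunc]; rfl
  have h1 := congrArg toRatFunc h
  simp only [map_add, map_mul, map_zero, hC] at h1
  have h2 : (α : RatFunc ℚ) * P + β * Q + γ = 0 := by
    rw [hP, hQ]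
    field_simp
    linear_combination h1
  rw [Fintype.linearIndependent_iff] at hPQ
  have h3 := hPQ ![(α : ℚ), β, γ] (by
    simpa [Fin.sum_univ_three, Algebra.smul_def] using h2)
  exact ⟨by simpa using h3 0, by simpa using h3 1⟩

/-- Counting solutions of a six-variable alternating equation from a fibre bound for
`(x, y) ↦ e x + e y` outside an exceptional set `T`. -/
theorem card_sextuples_le {X V : Type*} [DecidableEq X] [DecidableEq V] [AddCommGroup V]
    (U : Finset X) (e : X → V) (T : Finset (Fin 2 → X)) (k : ℕ)
    (hfib : ∀ s ∈ Fintype.piFinset fun _ : Fin 2 => U, s ∉ T →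
      ((Fintype.piFinset fun _ : Fin 2 => U).filter fun t =>
        e (t 0) + e (t 1) = e (s 0) + e (s 1)).card ≤ k) (v : V) :
    ((Fintype.piFinset fun _ : Fin 6 => U).filter fun y =>
      -e (y 0) + e (y 1) - e (y 2) + e (y 3) + e (y 4) - e (y 5) = v).card ≤
      (2 * k * U.card ^ 2 + T.card ^ 2) * U.card ^ 2 := by
  have hUU : (U ×ˢ U).card = U.card ^ 2 := by rw [Finset.card_product, sq]
  nth_rewrite 2 [← hUU]
  refine Finset.card_le_mul_card_image_of_maps_to (f := fun y : Fin 6 → X => (y 4, y 5)) ?_ _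
    fun b _ => ?_
  · intro y hy
    simp only [Finset.mem_filter, Fintype.mem_piFinset] at hy
    exact Finset.mem_product.mpr ⟨hy.1 4, hy.1 5⟩
  · have h := card_pairs_le (Fintype.piFinset fun _ : Fin 2 => U) T
      (fun s => e (s 0) + e (s 1)) k hfib (v - e b.1 + e b.2)
    rw [Fintype.card_piFinset_const] at h
    refine le_trans (Finset.card_le_card_of_injOn
      (fun y => (![y 1, y 3], ![y 0, y 2])) ?_ ?_) h
    · intro y hy
      simp only [Finset.coe_filter, Finset.mem_filter, Fintype.mem_piFinset,
        Set.mem_ofPred_eq, Finset.mem_product, Fin.forall_fin_two] at hy ⊢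
      obtain ⟨⟨hy, rfl⟩, rfl⟩ := hy
      refine ⟨⟨⟨hy 1, hy 3⟩, hy 0, hy 2⟩, ?_⟩
      simp only [Matrix.cons_val_zero, Matrix.cons_val_one]
      abel
    · intro y hy z hz hyz
      simp only [Finset.coe_filter, Finset.mem_filter, Set.mem_ofPred_eq] at hy hz
      have hb := hy.2.trans hz.2.symm
      simp only [Prod.mk.injEq, Matrix.vecCons_inj] at hb hyz
      ext i
      fin_cases i <;> simp_all

/-- **Step 8 of Theorem 4.2.** Uniform point count `|W_{a,b}(F_p)| ≪ p⁴` for the auxiliary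
varieties `W_{a,b}` in the six variables `(y₁₁,…,y₁₆)`. -/
theorem Wab_count (P Q : RatFunc ℚ)
    (hPQ : LinearIndependent ℚ ![P, Q, (1 : RatFunc ℚ)]) :
    ∃ C : ℝ, 0 < C ∧ ∀ (p : ℕ) [Fact p.Prime],
      Admissible p P → Admissible p Q →
      ∀ a b : ZMod p,
        (Nat.card {y : Fin 6 → ZMod p //
            (∀ i, ¬ IsPole p P (y i)) ∧ (∀ i, ¬ IsPole p Q (y i)) ∧
            -evalRed p P (y 0) + evalRed p P (y 1) - evalRed p P (y 2) +
                evalRed p P (y 3) + evalRed p P (y 4) - evalRed p P (y 5) = a ∧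
            -evalRed p Q (y 0) + evalRed p Q (y 1) - evalRed p Q (y 2) +
                evalRed p Q (y 3) + evalRed p Q (y 4) - evalRed p Q (y 5) = b} : ℝ) ≤
          C * (p : ℝ) ^ 4 := by
  obtain ⟨A, B, N₁, hN₁, hA, hB⟩ := exists_int_model P
  obtain ⟨G, H, N₂, hN₂, hG, hH⟩ := exists_int_model Q
  have hB0 := ne_zero_of_map_eq_denom hN₁ hB
  have hH0 := ne_zero_of_map_eq_denom hN₂ hH
  obtain ⟨k, M, N₃, hN₃, hfib⟩ := exists_fibre_bound hB0 hH0
    (eq_zero_of_linearIndependent hPQ hB0 hH0 (eq_toRatFunc_div hN₁ hA hB)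
      (eq_toRatFunc_div hN₂ hG hH))
  have hN : N₁ * N₂ * N₃ ≠ 0 := mul_ne_zero (mul_ne_zero hN₁ hN₂) hN₃
  set N := N₁ * N₂ * N₃ with hNdef
  refine ⟨((2 * k + M ^ 2 + N.natAbs ^ 2 : ℕ) : ℝ), ?_, fun p _ _ _ a b => ?_⟩
  · have := pow_pos (Int.natAbs_pos.mpr hN) 2
    exact_mod_cast (by omega : 0 < 2 * k + M ^ 2 + N.natAbs ^ 2)
  norm_cast
  by_cases hp : (p : ℤ) ∣ N
  · have hpN : p ≤ N.natAbs := Nat.le_of_dvd (Int.natAbs_pos.mpr hN) (Int.natCast_dvd.mp hp)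
    calc _ ≤ Nat.card (Fin 6 → ZMod p) := Finite.card_subtype_le _
      _ = p ^ 2 * p ^ 4 := by simp [← pow_add]
      _ ≤ _ := Nat.mul_le_mul_right _
        ((Nat.pow_le_pow_left hpN 2).trans (Nat.le_add_left _ _))
  have hp₁ : ¬ (p : ℤ) ∣ N₁ := fun h => hp ((h.mul_right N₂).mul_right N₃)
  have hp₂ : ¬ (p : ℤ) ∣ N₂ := fun h => hp ((h.mul_left N₁).mul_right N₃)
  have hp₃ : ¬ (p : ℤ) ∣ N₃ := fun h => hp (h.mul_left _)
  obtain ⟨T, hT, hR⟩ := hfib p hp₃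
  classical
  let U : Finset (ZMod p) := Finset.univ.filter fun y => ¬ IsPole p P y ∧ ¬ IsPole p Q y
  let e : ZMod p → ZMod p × ZMod p := fun y => (evalRed p P y, evalRed p Q y)
  have hU : U.card ≤ p := (Finset.card_le_univ _).trans_eq (ZMod.card p)
  have hreg : ∀ s : Fin 2 → ZMod p, s ∈ Fintype.piFinset (fun _ => U) ↔ Regular B H s := fun s => by
    simp [U, Regular, isPole_iff hp₁ hB, isPole_iff hp₂ hH]
  have he : ∀ s : Fin 2 → ZMod p, e (s 0) + e (s 1) = (fracSum A B s, fracSum G H s) := fun s => by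
    simp [e, fracSum, evalRed_eq_div hp₁ hA hB, evalRed_eq_div hp₂ hG hH]
  have hcount := card_sextuples_le U e T k (fun s hs hsT => by
    obtain ⟨R, hRk, hRs⟩ := hR s hsT ((hreg s).mp hs)
    refine (Finset.card_le_card fun t ht => ?_).trans hRk
    rw [Finset.mem_filter, hreg, he, he, Prod.mk.injEq] at ht
    exact hRs t ht.1 ht.2.1 ht.2.2) (a, b)
  rw [Nat.card_eq_fintype_card, Fintype.card_subtype]
  calc _ ≤ _ := Finset.card_le_card fun y hy => by
        rw [Finset.mem_filter] at hy ⊢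
        obtain ⟨-, h₁, h₂, h₃, h₄⟩ := hy
        exact ⟨by simpa [U] using fun i => ⟨h₁ i, h₂ i⟩, Prod.ext h₃ h₄⟩
    _ ≤ _ := hcount
    _ ≤ (2 * k * p ^ 2 + (M * p) ^ 2) * p ^ 2 := by gcongr
    _ = (2 * k + M ^ 2) * p ^ 4 := by ring
    _ ≤ _ := Nat.mul_le_mul_right _ (Nat.le_add_right _ _)
end RatCorners
end
end

section
/- There exists a constant C > 0 depending only on P and Q such that for every admissible prime p, the number of tuples (y1,…,y8) ∈ F_p^8, avoiding all poles of P, Q and R = P′/Q′, satisfying the three equations P(y1)−P(y2)−P(y3)+P(y4)−P(y5)+P(y6)+P(y7)−P(y8) = 0, Q(y1)−Q(y2)−Q(y3)+Q(y4)−Q(y5)+Q(y6)+Q(y7)−Q(y8) = 0, and R(y1)R(y4)R(y6)R(y7) − R(y2)R(y3)R(y5)R(y8) = 0, is at most C · p^5. -/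
open scoped BigOperators ComplexOrder
open Polynomial

noncomputable section

namespace RatCorners

variable (p : ℕ) [NeZero p]

variable (p : ℕ) [NeZero p]

/-- Evaluation at a point where `D` does not vanish, on the localization away from `D`. -/
def specialize {n : ℕ} {k : Type*} [Field k] (D : MvPolynomial (Fin n) ℤ) (y : Fin n → k)
    (h : MvPolynomial.aeval y D ≠ 0) : Localization.Away D →+* k :=
  IsLocalization.Away.lift D
    (g := (MvPolynomial.aeval y : MvPolynomial (Fin n) ℤ →ₐ[ℤ] k).toRingHom)
    (IsUnit.mk0 _ h)

@[simp]
lemma specialize_algebraMap {n : ℕ} {k : Type*} [Field k] (D : MvPolynomial (Fin n) ℤ)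
    (y : Fin n → k) (h : MvPolynomial.aeval y D ≠ 0) (q : MvPolynomial (Fin n) ℤ) :
    specialize D y h (algebraMap _ _ q) = MvPolynomial.aeval y q :=
  IsLocalization.Away.lift_eq _ _ _

lemma ringHom_aeval {σ A k : Type*} [CommRing A] [CommRing k] [Algebra ℤ A]
    [Algebra ℤ k] (φ : A →+* k) (F : σ → A)
    (G : MvPolynomial σ ℤ) :
    φ (MvPolynomial.aeval F G) = MvPolynomial.aeval (fun i => φ (F i)) G :=
  (MvPolynomial.map_aeval F φ G).trans (by
    rw [MvPolynomial.aeval_def, MvPolynomial.coe_eval₂Hom]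
    congr 1
    exact RingHom.ext_int _ _)

lemma isRoot_map_aeval {σ A k : Type*} [CommRing A] [CommRing k] [Algebra ℤ A] [Algebra ℤ k]
    (φ : A →+* k) (F : σ → A) (x : A) {W : (MvPolynomial σ ℤ)[X]}
    (hW : W.eval₂ (MvPolynomial.aeval F : MvPolynomial σ ℤ →ₐ[ℤ] A).toRingHom x = 0) :
    (W.map (MvPolynomial.aeval fun i => φ (F i) :
      MvPolynomial σ ℤ →ₐ[ℤ] k).toRingHom).IsRoot (φ x) := by
  have h := congrArg φ hW
  rw [map_zero, hom_eval₂] at h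
  rw [IsRoot.def, eval_map, ← h]
  congr 1
  exact RingHom.ext fun q => (ringHom_aeval φ F q).symm

lemma isDomain_away {n : ℕ} {D : MvPolynomial (Fin n) ℤ} (hD : D ≠ 0) :
    IsDomain (Localization.Away D) :=
  IsLocalization.isDomain_localization (powers_le_nonZeroDivisors_of_noZeroDivisors hD)

lemma exists_annihilator {n : ℕ} {D : MvPolynomial (Fin n) ℤ} (hD : D ≠ 0)
    {F : Fin n → Localization.Away D} (hF : AlgebraicIndependent ℤ F) (x : Localization.Away D) :
    ∃ W : (MvPolynomial (Fin n) ℤ)[X], W ≠ 0 ∧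
      W.eval₂ (MvPolynomial.aeval F : MvPolynomial (Fin n) ℤ →ₐ[ℤ] _).toRingHom x = 0 := by
  have := isDomain_away hD
  have hM := powers_le_nonZeroDivisors_of_noZeroDivisors hD
  have hinj : FaithfulSMul (MvPolynomial (Fin n) ℤ) (Localization.Away D) :=
    (faithfulSMul_iff_algebraMap_injective _ _).mpr (IsLocalization.injective _ hM)
  have halg : Algebra.IsAlgebraic (MvPolynomial (Fin n) ℤ) (Localization.Away D) :=
    IsLocalization.isAlgebraic _ (Submonoid.powers D)
  have hb := (IsTranscendenceBasis.mvPolynomial (Fin n) ℤ).algebraMap_comp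
    (A := Localization.Away D)
  have hbF : IsTranscendenceBasis ℤ F :=
    hF.isTranscendenceBasis_of_trdeg_le_of_finite hb.cardinalMk_eq_trdeg.ge
  obtain ⟨q, hq, hqx⟩ := hbF.isAlgebraic.isAlgebraic x
  refine ⟨q.map (hF.aevalEquiv.symm : _ →+* _), ?_, ?_⟩
  · rwa [Ne, Polynomial.map_eq_zero_iff]
    exact hF.aevalEquiv.symm.injective
  · rw [Polynomial.eval₂_map]
    rw [Polynomial.aeval_def] at hqx
    have key : (MvPolynomial.aeval F : MvPolynomial (Fin n) ℤ →ₐ[ℤ] _).toRingHom.comp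
        (hF.aevalEquiv.symm : _ →+* _) =
          algebraMap (Algebra.adjoin ℤ (Set.range F)) (Localization.Away D) := by
      refine RingHom.ext fun a => ?_
      have := hF.algebraMap_aevalEquiv (hF.aevalEquiv.symm a)
      rw [AlgEquiv.apply_symm_apply] at this
      exact this.symm
    rw [key]
    exact hqx

lemma exists_clear_away {n : ℕ} {D : MvPolynomial (Fin n) ℤ} {x : Localization.Away D}
    (hx : x ≠ 0) : ∃ N : MvPolynomial (Fin n) ℤ, N ≠ 0 ∧
      ∀ (k : Type) [Field k] (y : Fin n → k) (h : MvPolynomial.aeval y D ≠ 0),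
        specialize D y h x = 0 → MvPolynomial.aeval y N = 0 := by
  obtain ⟨⟨N, m⟩, hN⟩ := IsLocalization.surj (Submonoid.powers D) x
  refine ⟨N, ?_, fun k _ y h hy => ?_⟩
  · rintro rfl
    simp only [map_zero] at hN
    exact hx ((IsLocalization.map_units (Localization.Away D) m).mul_left_eq_zero.mp hN)
  · rw [← specialize_algebraMap D y h, ← hN, map_mul, hy, zero_mul]

lemma card_zeros_le_s13 {n p : ℕ} [Fact p.Prime] (hn : 0 < n) (q : MvPolynomial (Fin n) (ZMod p))
    (hq : q ≠ 0) :
    Nat.card {y : Fin n → ZMod p // MvPolynomial.eval y q = 0} ≤ q.totalDegree * p ^ (n - 1) := by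
  classical
  have hp : 0 < p := (Fact.out : p.Prime).pos
  have h := MvPolynomial.schwartz_zippel_totalDegree hq (Finset.univ : Finset (ZMod p))
  rw [Nat.card_eq_fintype_card, Fintype.card_subtype]
  simp only [Finset.card_univ, ZMod.card, Fintype.piFinset_univ] at h
  have hp' : (0 : ℚ≥0) < p := by exact_mod_cast hp
  obtain ⟨m, rfl⟩ : ∃ m, n = m + 1 := ⟨n - 1, by omega⟩
  rw [div_le_div_iff₀ (by positivity) hp', pow_succ, ← mul_assoc] at h
  have := le_of_mul_le_mul_right h hp'
  exact_mod_cast this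

lemma exists_bound_map_ne_zero {n : ℕ} {N : MvPolynomial (Fin n) ℤ} (hN : N ≠ 0) :
    ∃ B : ℕ, ∀ p : ℕ, B < p → N.map (Int.castRingHom (ZMod p)) ≠ 0 := by
  obtain ⟨m, hm⟩ := MvPolynomial.ne_zero_iff.mp hN
  refine ⟨(N.coeff m).natAbs, fun p hp h => ?_⟩
  have := congrArg (MvPolynomial.coeff m) h
  rw [MvPolynomial.coeff_map, MvPolynomial.coeff_zero, eq_intCast,
    ZMod.intCast_zmod_eq_zero_iff_dvd] at this
  exact hm (Int.eq_zero_of_dvd_of_natAbs_lt_natAbs this (by simpa using hp))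

lemma card_image_zero_le {n : ℕ} (hn : 0 < n) {D : MvPolynomial (Fin n) ℤ}
    {x : Localization.Away D} (hx : x ≠ 0) :
    ∃ K : ℕ, ∀ p : ℕ, [Fact p.Prime] → K < p →
      Nat.card {y : Fin n → ZMod p // ∃ h : MvPolynomial.aeval y D ≠ 0, specialize D y h x = 0} ≤
        K * p ^ (n - 1) := by
  obtain ⟨N, hN, hNy⟩ := exists_clear_away hx
  obtain ⟨B, hB⟩ := exists_bound_map_ne_zero hN
  refine ⟨max B N.totalDegree, fun p _ hp => ?_⟩
  calc _ ≤ Nat.card {y : Fin n → ZMod p //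
        MvPolynomial.eval y (N.map (Int.castRingHom (ZMod p))) = 0} := by
        refine Nat.card_mono (Set.toFinite _) ?_
        rintro y ⟨h, hy⟩
        have := hNy _ y h hy
        rwa [MvPolynomial.aeval_def, MvPolynomial.eval₂_eq_eval_map] at this
    _ ≤ _ := card_zeros_le_s13 hn _ (hB p (lt_of_le_of_lt (le_max_left _ _) hp))
    _ ≤ _ := by
        gcongr
        exact (Finset.sup_mono (MvPolynomial.support_map_subset _ _)).trans (le_max_right _ _)

/-- A dominant map between affine spaces has uniformly bounded fibers modulo every large prime,
outside a set of values whose preimage has positive codimension. -/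
lemma exists_fiber_bound {n : ℕ} (hn : 0 < n) {D : MvPolynomial (Fin n) ℤ} (hD : D ≠ 0)
    {F : Fin n → Localization.Away D} (hF : AlgebraicIndependent ℤ F) :
    ∃ K : ℕ, ∀ p : ℕ, [Fact p.Prime] → K < p → ∃ Bad : Set (Fin n → ZMod p),
      (∀ g ∉ Bad, Nat.card {y : Fin n → ZMod p // ∃ h : MvPolynomial.aeval y D ≠ 0,
        (fun i => specialize D y h (F i)) = g} ≤ K) ∧
      Nat.card {y : Fin n → ZMod p // ∃ h : MvPolynomial.aeval y D ≠ 0,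
        (fun i => specialize D y h (F i)) ∈ Bad} ≤ K * p ^ (n - 1) := by
  classical
  choose W hW hWx using fun i : Fin n =>
    exists_annihilator hD hF (algebraMap (MvPolynomial (Fin n) ℤ) _ (MvPolynomial.X i))
  set B : MvPolynomial (Fin n) ℤ := ∏ i, (W i).leadingCoeff with hB
  have hB0 : B ≠ 0 := Finset.prod_ne_zero_iff.mpr fun i _ => leadingCoeff_ne_zero.mpr (hW i)
  have hx : MvPolynomial.aeval F B ≠ 0 := by
    rw [Ne, ← map_zero (MvPolynomial.aeval F : MvPolynomial (Fin n) ℤ →ₐ[ℤ] _)]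
    exact fun h => hB0 (hF h)
  obtain ⟨K, hK⟩ := card_image_zero_le hn hx
  refine ⟨max K (∏ i, (W i).natDegree), fun p _ hp =>
    ⟨{g | MvPolynomial.aeval g B = 0}, fun g hg => ?_, ?_⟩⟩
  · let ψ : MvPolynomial (Fin n) ℤ →+* ZMod p :=
      (MvPolynomial.aeval g : MvPolynomial (Fin n) ℤ →ₐ[ℤ] _).toRingHom
    have hne : ∀ i, (W i).map ψ ≠ 0 := fun i h => by
      have h1 := congrArg (fun q => q.coeff (W i).natDegree) h
      simp only [coeff_map, coeff_zero, coeff_natDegree] at h1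
      refine hg ?_
      change MvPolynomial.aeval g B = 0
      rw [hB, map_prod]
      exact Finset.prod_eq_zero (Finset.mem_univ i) h1
    calc _ ≤ Nat.card {y : Fin n → ZMod p //
          y ∈ Fintype.piFinset fun i => ((W i).map ψ).roots.toFinset} := by
          refine Nat.card_mono (Set.toFinite _) ?_
          rintro y ⟨h, hy⟩
          refine Fintype.mem_piFinset.mpr fun i => ?_
          rw [Multiset.mem_toFinset, mem_roots (hne i)]
          have h2 := isRoot_map_aeval (specialize D y h) F _ (hWx i)
          rw [hy, specialize_algebraMap, MvPolynomial.aeval_X] at h2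
          exact h2
      _ = ∏ i, ((W i).map ψ).roots.toFinset.card := by
          rw [Nat.card_eq_fintype_card, Fintype.card_coe, Fintype.card_piFinset]
      _ ≤ ∏ i, (W i).natDegree := by
          refine Finset.prod_le_prod' fun i _ => ?_
          exact (Multiset.toFinset_card_le _).trans ((card_roots' _).trans natDegree_map_le)
      _ ≤ _ := le_max_right _ _
  · calc _ ≤ Nat.card {y : Fin n → ZMod p // ∃ h : MvPolynomial.aeval y D ≠ 0,
            specialize D y h (MvPolynomial.aeval F B) = 0} := by
          refine Nat.card_mono (Set.toFinite _) ?_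
          rintro y ⟨h, hy⟩
          refine ⟨h, ?_⟩
          rw [ringHom_aeval]
          exact hy
      _ ≤ K * p ^ (n - 1) := hK p (lt_of_le_of_lt (le_max_left _ _) hp)
      _ ≤ _ := by gcongr; exact le_max_left _ _

/-- The Jacobian criterion for algebraic independence, at a single real point. -/
lemma algebraicIndependent_of_hasStrictFDerivAt {n : ℕ} {D : MvPolynomial (Fin n) ℤ}
    {F : Fin n → Localization.Away D} (f : (Fin n → ℝ) → Fin n → ℝ)
    (hf : ∀ y (h : MvPolynomial.aeval y D ≠ 0), (fun i => specialize D y h (F i)) = f y)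
    {y₀ : Fin n → ℝ} (h₀ : MvPolynomial.aeval y₀ D ≠ 0)
    {f' : (Fin n → ℝ) →L[ℝ] Fin n → ℝ} (hd : HasStrictFDerivAt f f' y₀)
    (hs : Function.Surjective f') : AlgebraicIndependent ℤ F := by
  rw [algebraicIndependent_iff]
  intro G hG
  have hU : {y : Fin n → ℝ | MvPolynomial.aeval y D ≠ 0} ∈ nhds y₀ := by
    refine IsOpen.mem_nhds (isOpen_ne_fun ?_ continuous_const) h₀
    simp only [MvPolynomial.aeval_def, MvPolynomial.eval₂_eq_eval_map]
    exact MvPolynomial.continuous_eval _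
  have hnhds := Filter.image_mem_map (m := f) hU
  rw [hd.map_nhds_eq_of_surj (LinearMap.range_eq_top.mpr hs), Metric.mem_nhds_iff] at hnhds
  obtain ⟨ε, hε, hball⟩ := hnhds
  refine MvPolynomial.map_injective (Int.castRingHom ℝ) Int.cast_injective ?_
  refine MvPolynomial.funext_set (fun i => Metric.ball (f y₀ i) ε) (fun i => ?_) fun z hz => ?_
  · rw [Real.ball_eq_Ioo]
    exact Set.Ioo_infinite (by linarith)
  · rw [← ball_pi _ hε] at hz
    obtain ⟨y, hy, rfl⟩ := hball hz
    rw [map_zero, map_zero, ← hf y hy]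
    have := ringHom_aeval (specialize D y hy) F G
    rw [hG, map_zero, MvPolynomial.aeval_def, MvPolynomial.eval₂_eq_eval_map] at this
    exact this.symm

/-- The value of the quotient `a / d` of integer polynomials at a point of a field. -/
def ratio {k : Type*} [Field k] (a d : ℤ[X]) (y : k) : k := aeval y a / aeval y d

/-- The product of the `d (X j)`. -/
def prodX (n : ℕ) (d : ℤ[X]) : MvPolynomial (Fin n) ℤ :=
  ∏ j, aeval (MvPolynomial.X j : MvPolynomial (Fin n) ℤ) d

/-- The numerator of `∑ j, a (X j) / d (X j)` over the common denominator `prodX n d`. -/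
def sumX (n : ℕ) (a d : ℤ[X]) : MvPolynomial (Fin n) ℤ :=
  ∑ j, aeval (MvPolynomial.X j : MvPolynomial (Fin n) ℤ) a *
    ∏ l ∈ Finset.univ.erase j, aeval (MvPolynomial.X l : MvPolynomial (Fin n) ℤ) d

/-- The quotient `N / D` in the localization away from `D`. -/
def overD {n : ℕ} (D N : MvPolynomial (Fin n) ℤ) : Localization.Away D :=
  algebraMap _ _ N * IsLocalization.Away.invSelf D

lemma aeval_aeval_X {n : ℕ} {k : Type*} [Field k] (d : ℤ[X]) (y : Fin n → k) (j : Fin n) :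
    MvPolynomial.aeval y (aeval (MvPolynomial.X j : MvPolynomial (Fin n) ℤ) d) =
      aeval (y j) d := by
  rw [← Polynomial.aeval_algHom_apply, MvPolynomial.aeval_X]

lemma aeval_prodX {n : ℕ} {k : Type*} [Field k] (d : ℤ[X]) (y : Fin n → k) :
    MvPolynomial.aeval y (prodX n d) = ∏ j, aeval (y j) d := by
  simp only [prodX, map_prod, aeval_aeval_X]

lemma aeval_prodX_ne_zero {n : ℕ} {k : Type*} [Field k] (d : ℤ[X]) (y : Fin n → k) :
    MvPolynomial.aeval y (prodX n d) ≠ 0 ↔ ∀ j, aeval (y j) d ≠ 0 := by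
  simp [aeval_prodX, Finset.prod_ne_zero_iff]

lemma prodX_ne_zero (n : ℕ) {d : ℤ[X]} (hd : d ≠ 0) : prodX n d ≠ 0 := by
  refine Finset.prod_ne_zero_iff.mpr fun j _ h => hd ?_
  exact (transcendental_iff.mp (MvPolynomial.transcendental_X ℤ j)) d h

lemma specialize_overD {n : ℕ} {k : Type*} [Field k] (D N : MvPolynomial (Fin n) ℤ)
    (y : Fin n → k) (h : MvPolynomial.aeval y D ≠ 0) :
    specialize D y h (overD D N) = MvPolynomial.aeval y N / MvPolynomial.aeval y D := by
  rw [overD, map_mul, specialize_algebraMap, eq_div_iff h, mul_assoc,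
    ← specialize_algebraMap D y h D, ← map_mul, mul_comm (IsLocalization.Away.invSelf D),
    IsLocalization.Away.mul_invSelf, map_one, mul_one]

lemma specialize_sumX {n : ℕ} {k : Type*} [Field k] (a d : ℤ[X])
    (y : Fin n → k) (h : MvPolynomial.aeval y (prodX n d) ≠ 0) :
    specialize _ y h (overD (prodX n d) (sumX n a d)) = ∑ j, ratio a d (y j) := by
  have h' := (aeval_prodX_ne_zero d y).mp h
  rw [specialize_overD, aeval_prodX, sumX, map_sum, Finset.sum_div]
  refine Finset.sum_congr rfl fun j _ => ?_
  rw [map_mul, map_prod, ← Finset.mul_prod_erase Finset.univ _ (Finset.mem_univ j), ratio]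
  simp only [aeval_aeval_X]
  exact mul_div_mul_right _ _ (Finset.prod_ne_zero_iff.mpr fun l _ => h' l)

lemma specialize_prodX {n : ℕ} {k : Type*} [Field k] (c d : ℤ[X])
    (y : Fin n → k) (h : MvPolynomial.aeval y (prodX n d) ≠ 0) :
    specialize _ y h (overD (prodX n d) (prodX n c)) = ∏ j, ratio c d (y j) := by
  simp only [specialize_overD, aeval_prodX, ratio, Finset.prod_div_distrib]

lemma hasStrictDerivAt_ratio (a d : ℤ[X]) {y : ℝ} (h : aeval y d ≠ 0) :
    HasStrictDerivAt (ratio a d : ℝ → ℝ)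
      (aeval y (derivative a * d - a * derivative d) / aeval y d ^ 2) y := by
  simp only [map_sub, map_mul]
  exact (a.hasStrictDerivAt_aeval y).div (d.hasStrictDerivAt_aeval y) h

lemma not_dvd_of_wronskian_eq {K : Type*} [Field K] [CharZero K] {u v r s π : K[X]}
    (hπ : Irreducible π) (huv : IsCoprime u v) (hrs : IsCoprime r s) (hu : u ≠ 0) (hs : s ≠ 0)
    (h : wronskian v u * s ^ 2 = wronskian s r * (u * v)) : ¬ π ∣ u := by
  intro hπu
  have hp : Prime π := hπ.prime
  have hπ' : ¬ π ∣ derivative π := fun hd => by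
    have h1 : derivative π ≠ 0 := fun h0 => by
      exact hπ.natDegree_pos.ne' (derivative_eq_zero.mp h0)
    have h2 := degree_le_of_dvd hd h1
    exact (degree_derivative_lt hπ.ne_zero).not_ge h2
  have hmul : ∀ (k : ℕ) {x : K[X]}, π ∣ C ((k : K) + 1) * x → π ∣ x := fun k x hx => by
    have : IsUnit (C ((k : K) + 1)) := isUnit_C.mpr (IsUnit.mk0 _ (Nat.cast_add_one_ne_zero k))
    exact (this.dvd_mul_left).mp hx
  obtain ⟨m, w, hw, rfl⟩ := WfDvdMonoid.max_power_factor hu hπ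
  obtain ⟨m, rfl⟩ : ∃ k, m = k + 1 := ⟨m - 1, by
    have : m ≠ 0 := by rintro rfl; simp at hπu; exact hw hπu
    omega⟩
  have hv : ¬ π ∣ v := fun hv => hπ.not_isUnit (huv.isUnit_of_dvd' hπu hv)
  have e1 : ((C ((m : K) + 1) * derivative π * w + π * derivative w) * v - π * w * derivative v) *
      s ^ 2
      = wronskian s r * (π * w * v) := by
    refine mul_left_cancel₀ (pow_ne_zero m hπ.ne_zero) ?_
    simp only [wronskian, derivative_mul, derivative_pow_succ] at h ⊢
    linear_combination h
  have hs2 : π ∣ s := by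
    have : π ∣ C ((m : K) + 1) * (derivative π * w * v * s ^ 2) :=
      ⟨wronskian s r * (w * v) - (derivative w * v - w * derivative v) * s ^ 2, by
        linear_combination e1⟩
    rcases hp.dvd_or_dvd (hmul _ this) with h1 | h1
    · rcases hp.dvd_or_dvd h1 with h1 | h1
      · rcases hp.dvd_or_dvd h1 with h1 | h1
        · exact absurd h1 hπ'
        · exact absurd h1 hw
      · exact absurd h1 hv
    · exact hp.dvd_of_dvd_pow h1
  have hr : ¬ π ∣ r := fun hr => hπ.not_isUnit (hrs.isUnit_of_dvd' hr hs2)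
  obtain ⟨k, q, hq, rfl⟩ := WfDvdMonoid.max_power_factor hs hπ
  obtain ⟨k, rfl⟩ : ∃ l, k = l + 1 := ⟨k - 1, by
    have : k ≠ 0 := by rintro rfl; simp at hs2; exact hq hs2
    omega⟩
  have e2 : ((C ((m : K) + 1) * derivative π * w + π * derivative w) * v - π * w * derivative v) *
      (π ^ (k + 1) * q ^ 2) =
      (π * q * derivative r - (C ((k : K) + 1) * derivative π * q + π * derivative q) * r) *
        (w * v) := by
    refine mul_left_cancel₀ (pow_ne_zero (k + 1) hπ.ne_zero) ?_
    simp only [wronskian, derivative_mul, derivative_pow_succ] at e1 ⊢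
    linear_combination e1
  have : π ∣ C ((k : K) + 1) * (derivative π * q * r * w * v) :=
    ⟨(q * derivative r - derivative q * r) * (w * v) -
      ((C ((m : K) + 1) * derivative π * w + π * derivative w) * v - π * w * derivative v) *
      (π ^ k * q ^ 2), by linear_combination e2⟩
  have := hmul _ this
  simp only [hp.dvd_mul] at this
  tauto

lemma exists_isCoprime_factor {K : Type*} [Field K] (x : K[X]) {y : K[X]} (hy : y ≠ 0) :
    ∃ g x₀ y₀ : K[X], g ≠ 0 ∧ x = g * x₀ ∧ y = g * y₀ ∧ IsCoprime x₀ y₀ := by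
  classical
  refine ⟨gcd x y, x / gcd x y, y / gcd x y, gcd_ne_zero_of_right hy, ?_, ?_,
    isCoprime_div_gcd_div_gcd hy⟩
  · exact (EuclideanDomain.mul_div_cancel' (gcd_ne_zero_of_right hy) (gcd_dvd_left _ _)).symm
  · exact (EuclideanDomain.mul_div_cancel' (gcd_ne_zero_of_right hy) (gcd_dvd_right _ _)).symm

lemma wronskian_mul_mul {K : Type*} [Field K] (g x y : K[X]) :
    wronskian (g * x) (g * y) = g ^ 2 * wronskian x y := by
  simp only [wronskian, derivative_mul]
  ring

/-- A nonconstant quotient `u / v` has no logarithmic derivative of the form `(r / s)'`. -/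
lemma wronskian_eq_zero_of_logDeriv {K : Type*} [Field K] [CharZero K] {u v r s : K[X]}
    (hu : u ≠ 0) (hv : v ≠ 0) (hs : s ≠ 0)
    (h : wronskian v u * s ^ 2 = wronskian s r * (u * v)) : wronskian v u = 0 := by
  obtain ⟨g, u, v, hg, rfl, rfl, huv⟩ := exists_isCoprime_factor u hv
  obtain ⟨e, r, s, he, rfl, rfl, hrs⟩ := exists_isCoprime_factor r hs
  rw [wronskian_mul_mul, wronskian_mul_mul] at h
  replace h : wronskian v u * s ^ 2 = wronskian s r * (u * v) :=
    mul_left_cancel₀ (mul_ne_zero (pow_ne_zero 2 hg) (pow_ne_zero 2 he))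
      (by linear_combination h)
  have hu' := right_ne_zero_of_mul hu
  have hv' := right_ne_zero_of_mul hv
  have hs' := right_ne_zero_of_mul hs
  have h' : wronskian u v * s ^ 2 = wronskian s (-r) * (v * u) := by
    rw [← wronskian_neg_eq v u, wronskian_neg_right]
    linear_combination -h
  have key : ∀ x : K[X], x ≠ 0 → (∀ π, Irreducible π → ¬ π ∣ x) → derivative x = 0 := by
    intro x hx hπ
    have : IsUnit x := by
      by_contra hx'
      obtain ⟨π, h1, h2⟩ := WfDvdMonoid.exists_irreducible_factor hx' hx
      exact hπ π h1 h2
    obtain ⟨c, -, rfl⟩ := isUnit_iff.mp this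
    exact derivative_C
  have du := key u hu' fun π hπ => not_dvd_of_wronskian_eq hπ huv hrs hu' hs' h
  have dv := key v hv' fun π hπ => not_dvd_of_wronskian_eq hπ huv.symm hrs.neg_left hv' hs' h'
  rw [wronskian_mul_mul, wronskian, du, dv]
  simp

lemma exists_eq_C_mul_of_wronskian_eq_zero {K : Type*} [Field K] [CharZero K] {x y : K[X]}
    (hy : y ≠ 0) (h : wronskian y x = 0) : ∃ t : K, x = C t * y := by
  obtain ⟨g, x, y, hg, rfl, rfl, hxy⟩ := exists_isCoprime_factor x hy
  rw [wronskian_mul_mul] at h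
  obtain ⟨h1, h2⟩ := hxy.symm.wronskian_eq_zero_iff.mp
    ((mul_eq_zero.mp h).resolve_left (pow_ne_zero 2 hg))
  have hy' := right_ne_zero_of_mul hy
  rw [eq_C_of_derivative_eq_zero h1] at hy' ⊢
  rw [eq_C_of_derivative_eq_zero h2]
  refine ⟨x.coeff 0 / y.coeff 0, ?_⟩
  have : y.coeff 0 ≠ 0 := by simpa using hy'
  rw [mul_left_comm, ← C_mul, div_mul_cancel₀ _ this]

lemma linearIndependent_wronskian {K : Type*} [Field K] [CharZero K] {a b c d : K[X]}
    (hd : d ≠ 0) (hab : LinearIndependent K ![a, b, d])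
    (hc : c * wronskian d b = wronskian d a * d) :
    c ≠ 0 ∧ LinearIndependent K
      ![wronskian d a * c, wronskian d b * c, wronskian d c * d] := by
  have hlin : ∀ l m t : K, C l * a + C m * b = C t * d → l = 0 ∧ m = 0 := by
    intro l m t h
    have := Fintype.linearIndependent_iff.mp hab ![l, m, -t] (by
      simp only [Fin.sum_univ_three, smul_eq_C_mul]
      simp
      linear_combination h)
    exact ⟨this 0, this 1⟩
  have hW : ∀ l m : K, wronskian d (C l * a + C m * b) =
      C l * wronskian d a + C m * wronskian d b := by
    intro l m
    simp only [wronskian, derivative_add, derivative_C_mul]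
    ring
  have hW0 : ∀ l m : K, wronskian d (C l * a + C m * b) = 0 → l = 0 ∧ m = 0 := by
    intro l m h
    obtain ⟨t, ht⟩ := exists_eq_C_mul_of_wronskian_eq_zero hd h
    exact hlin l m t ht
  have hc0 : c ≠ 0 := by
    rintro rfl
    rw [zero_mul, eq_comm, mul_eq_zero, or_iff_left hd] at hc
    exact one_ne_zero (hW0 1 0 (by rw [hW, hc]; simp)).1
  refine ⟨hc0, ?_⟩
  rw [Fintype.linearIndependent_iff]
  intro g hg
  simp only [Fin.sum_univ_three, smul_eq_C_mul, Matrix.cons_val] at hg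
  have h2 : g 2 = 0 := by
    by_contra h2
    have hC : C (g 2) * C (g 2)⁻¹ = 1 := by rw [← C_mul, mul_inv_cancel₀ h2, C_1]
    have hκ := wronskian_eq_zero_of_logDeriv (u := c) (v := d) (s := d)
      (r := C (-(g 2)⁻¹ * g 0) * a + C (-(g 2)⁻¹ * g 1) * b) hc0 hd hd (by
        rw [hW]
        simp only [C_mul, C_neg]
        linear_combination (C (g 2)⁻¹ * d) * hg - wronskian d c * d ^ 2 * hC)
    obtain ⟨t, rfl⟩ := exists_eq_C_mul_of_wronskian_eq_zero hd hκ
    have h3 : wronskian d (C (-1) * a + C t * b) = 0 := by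
      rw [hW]
      refine mul_right_cancel₀ hd ?_
      simp only [C_neg, C_1]
      linear_combination hc
    exact one_ne_zero (neg_eq_zero.mp (hW0 _ _ h3).1)
  rw [h2] at hg
  have h01 := hW0 (g 0) (g 1) (by
    rw [hW]
    refine mul_right_cancel₀ hc0 ?_
    simp only [C_0] at hg
    linear_combination hg)
  intro i
  fin_cases i
  exacts [h01.1, h01.2, h2]

/-- Linearly independent polynomials have a nonvanishing alternant at suitable points. -/
lemma exists_alternant_ne_zero {K : Type*} [Field K] [Infinite K] {n : ℕ} {h : Fin n → K[X]}
    (hh : LinearIndependent K h) {e : K[X]} (he : e ≠ 0) :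
    ∃ y : Fin n → K, (∀ j, e.eval (y j) ≠ 0) ∧
      (Matrix.of fun i j => (h i).eval (y j)).det ≠ 0 := by
  set S : Set (Fin n → K) := {v | ∃ t, e.eval t ≠ 0 ∧ v = fun i => (h i).eval t} with hS
  have hspan : Submodule.span K S = ⊤ := by
    by_contra hne
    obtain ⟨f, hf0, hf⟩ := Submodule.exists_le_ker_of_lt_top _ (lt_top_iff_ne_top.mpr hne)
    have hfv : ∀ v : Fin n → K, f v = ∑ i, v i * f (Pi.single i 1) := fun v => by
      conv_lhs => rw [pi_eq_sum_univ' v]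
      simp
    refine hf0 (LinearMap.ext fun v => ?_)
    have hz : (∑ i, f (Pi.single i 1) • h i) * e = 0 := by
      refine Polynomial.funext fun t => ?_
      rw [eval_mul, eval_zero, mul_eq_zero, or_iff_not_imp_right]
      intro ht
      have : f (fun i => (h i).eval t) = 0 := hf (Submodule.subset_span ⟨t, ht, rfl⟩)
      rw [hfv] at this
      simpa [eval_finsetSum, mul_comm] using this
    have hz' := Fintype.linearIndependent_iff.mp hh _ ((mul_eq_zero.mp hz).resolve_right he)
    rw [hfv]
    simp [hz']
  obtain ⟨f, hfS, -, hfi⟩ := Submodule.exists_fun_fin_finrank_span_eq K S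
  have hn : Module.finrank K (Submodule.span K S) = n := by
    rw [hspan, finrank_top, Module.finrank_fin_fun]
  choose t ht hft using hfS
  refine ⟨fun j => t (Fin.cast hn.symm j), fun j => ht _, ?_⟩
  have hcol : (Matrix.of fun i j => (h i).eval (t (Fin.cast hn.symm j))).col =
      f ∘ Fin.cast hn.symm := by
    ext j i
    simp [hft]
  have hrow := hfi.comp (Fin.cast hn.symm) (Fin.cast_injective _)
  rw [← hcol] at hrow
  exact ((Matrix.isUnit_iff_isUnit_det _).mp
    (Matrix.linearIndependent_cols_iff_isUnit.mp hrow)).ne_zero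

lemma aeval_ratCast (q : ℤ[X]) (t : ℚ) :
    aeval (t : ℝ) q = (((q.map (Int.castRingHom ℚ)).eval t : ℚ) : ℝ) := by
  rw [eval_map, ← eq_ratCast (Rat.castHom ℝ) (eval₂ _ _ _), hom_eval₂, aeval_def]
  congr 1

lemma exists_real_alternant_ne_zero {n : ℕ} {h : Fin n → ℤ[X]}
    (hh : LinearIndependent ℚ fun i => (h i).map (Int.castRingHom ℚ)) {e : ℤ[X]} (he : e ≠ 0) :
    ∃ y : Fin n → ℝ, (∀ j, aeval (y j) e ≠ 0) ∧
      (Matrix.of fun i j => aeval (y j) (h i)).det ≠ 0 := by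
  have he' : e.map (Int.castRingHom ℚ) ≠ 0 :=
    (Polynomial.map_ne_zero_iff Int.cast_injective).mpr he
  obtain ⟨y, hy, hdet⟩ := exists_alternant_ne_zero hh he'
  refine ⟨fun j => y j, fun j => ?_, ?_⟩
  · rw [aeval_ratCast]
    exact_mod_cast hy j
  · simp only [aeval_ratCast]
    have := RingHom.map_det (Rat.castHom ℝ)
      (Matrix.of fun i j => ((h i).map (Int.castRingHom ℚ)).eval (y j))
    have h2 := (map_ne_zero (Rat.castHom ℝ)).mpr hdet
    rw [this] at h2
    exact h2

lemma surjective_of_scaled_det_ne_zero {n : ℕ} {M : Matrix (Fin n) (Fin n) ℝ} (hM : M.det ≠ 0)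
    {ρ s : Fin n → ℝ} (hρ : ∀ i, ρ i ≠ 0) (hs : ∀ j, s j ≠ 0)
    {f : (Fin n → ℝ) → Fin n → ℝ} (hf : ∀ v i, f v i = ρ i * ∑ j, M i j * (s j * v j)) :
    Function.Surjective f := by
  intro w
  refine ⟨fun j => (s j)⁻¹ * (M⁻¹.mulVec fun i => (ρ i)⁻¹ * w i) j, funext fun i => ?_⟩
  have h1 : M.mulVec (M⁻¹.mulVec fun i => (ρ i)⁻¹ * w i) = fun i => (ρ i)⁻¹ * w i := by
    rw [Matrix.mulVec_mulVec, Matrix.mul_nonsing_inv _ (isUnit_iff_ne_zero.mpr hM),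
      Matrix.one_mulVec]
  rw [hf]
  simp only [mul_inv_cancel_left₀ (hs _)]
  rw [← mul_inv_cancel_left₀ (hρ i) (w i)]
  congr 1
  exact congrFun h1 i

lemma hasStrictFDerivAt_ratio {n : ℕ} (a d : ℤ[X]) {y : Fin n → ℝ} {j : Fin n}
    (h : aeval (y j) d ≠ 0) :
    HasStrictFDerivAt (fun y : Fin n → ℝ => ratio a d (y j))
      ((aeval (y j) (wronskian d a) / aeval (y j) d ^ 2) •
        ContinuousLinearMap.proj (R := ℝ) (φ := fun _ : Fin n => ℝ) j) y := by
  have h1 := (hasStrictDerivAt_ratio a d h).comp_hasStrictFDerivAt y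
    (ContinuousLinearMap.proj (R := ℝ) (φ := fun _ : Fin n => ℝ) j).hasStrictFDerivAt
  have e : wronskian d a = derivative a * d - a * derivative d := by
    rw [wronskian]
    ring
  rw [e]
  exact h1

lemma map_wronskian {R S : Type*} [CommRing R] [CommRing S] (φ : R →+* S) (x y : R[X]) :
    (wronskian x y).map φ = wronskian (x.map φ) (y.map φ) := by
  simp [wronskian, derivative_map]

/-- The integral numerator data of three rational functions `a / d`, `b / d`, `c / d` such that
`a / d`, `b / d` and `1` are linearly independent and `c / d = (a / d)' / (b / d)'`. -/
structure IsCornerData (a b c d : ℤ[X]) : Prop where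
  denom_ne_zero : d ≠ 0
  linearIndependent : LinearIndependent ℚ
    ![a.map (Int.castRingHom ℚ), b.map (Int.castRingHom ℚ), d.map (Int.castRingHom ℚ)]
  deriv_eq : c * wronskian d b = wronskian d a * d

namespace IsCornerData

variable {a b c d : ℤ[X]}

lemma ne_zero_and_linearIndependent (H : IsCornerData a b c d) : c ≠ 0 ∧
    LinearIndependent ℚ fun i =>
    (![wronskian d a * c, wronskian d b * c, wronskian d c * d] i).map (Int.castRingHom ℚ) := by
  have h := linearIndependent_wronskian
    ((Polynomial.map_ne_zero_iff Int.cast_injective).mpr H.denom_ne_zero) H.linearIndependent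
    (c := c.map (Int.castRingHom ℚ)) (by
      simp only [← map_wronskian, ← Polynomial.map_mul, H.deriv_eq])
  refine ⟨(Polynomial.map_ne_zero_iff Int.cast_injective).mp h.1, ?_⟩
  have e : (fun i => (![wronskian d a * c, wronskian d b * c, wronskian d c * d] i).map
      (Int.castRingHom ℚ)) = ![wronskian (d.map (Int.castRingHom ℚ)) (a.map (Int.castRingHom ℚ)) *
        c.map (Int.castRingHom ℚ), wronskian (d.map (Int.castRingHom ℚ))
        (b.map (Int.castRingHom ℚ)) * c.map (Int.castRingHom ℚ), wronskian
        (d.map (Int.castRingHom ℚ)) (c.map (Int.castRingHom ℚ)) * d.map (Int.castRingHom ℚ)] := by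
    ext1 i
    fin_cases i <;> simp [map_wronskian]
  rw [e]
  exact h.2

lemma ne_zero (H : IsCornerData a b c d) : c ≠ 0 := H.ne_zero_and_linearIndependent.1

lemma algebraicIndependent_two (H : IsCornerData a b c d) :
    AlgebraicIndependent ℤ ![overD (prodX 2 d) (sumX 2 a d), overD (prodX 2 d) (sumX 2 b d)] := by
  have hlin : LinearIndependent ℚ fun i : Fin 2 =>
      (![wronskian d a * c, wronskian d b * c] i).map (Int.castRingHom ℚ) := by
    convert H.ne_zero_and_linearIndependent.2.comp (Fin.castSucc : Fin 2 → Fin 3)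
      (Fin.castSucc_injective _) using 1
    ext1 i
    fin_cases i <;> rfl
  obtain ⟨y, hy, hdet⟩ := exists_real_alternant_ne_zero hlin (mul_ne_zero H.ne_zero H.denom_ne_zero)
  simp only [map_mul, mul_ne_zero_iff] at hy
  refine algebraicIndependent_of_hasStrictFDerivAt
    (fun y => ![∑ j, ratio a d (y j), ∑ j, ratio b d (y j)]) (fun y h => ?_)
    ((aeval_prodX_ne_zero d y).mpr fun j => (hy j).2)
    (f' := ContinuousLinearMap.pi ![_, _])
    (hasStrictFDerivAt_pi'.mpr (Fin.forall_fin_two.mpr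
      ⟨HasStrictFDerivAt.fun_sum fun j _ => hasStrictFDerivAt_ratio a d (hy j).2,
        HasStrictFDerivAt.fun_sum fun j _ => hasStrictFDerivAt_ratio b d (hy j).2⟩)) ?_
  · ext i
    fin_cases i <;> simp [specialize_sumX]
  · refine surjective_of_scaled_det_ne_zero hdet (ρ := fun _ => 1)
      (s := fun j => (aeval (y j) d ^ 2 * aeval (y j) c)⁻¹) (fun _ => one_ne_zero)
      (fun j => inv_ne_zero (mul_ne_zero (pow_ne_zero 2 (hy j).2) (hy j).1)) fun v i => ?_
    have h1 := fun j => (hy j).1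
    have h2 := fun j => (hy j).2
    fin_cases i <;> simp [Fin.sum_univ_two] <;> field_simp [h1, h2]

lemma algebraicIndependent_three (H : IsCornerData a b c d) :
    AlgebraicIndependent ℤ ![overD (prodX 3 d) (sumX 3 a d), overD (prodX 3 d) (sumX 3 b d),
      overD (prodX 3 d) (prodX 3 c)] := by
  obtain ⟨y, hy, hdet⟩ := exists_real_alternant_ne_zero H.ne_zero_and_linearIndependent.2
    (mul_ne_zero H.ne_zero H.denom_ne_zero)
  simp only [map_mul, mul_ne_zero_iff] at hy
  refine algebraicIndependent_of_hasStrictFDerivAt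
    (fun y => ![∑ j, ratio a d (y j), ∑ j, ratio b d (y j), ∏ j, ratio c d (y j)]) (fun y h => ?_)
    ((aeval_prodX_ne_zero d y).mpr fun j => (hy j).2)
    (f' := ContinuousLinearMap.pi ![_, _, _])
    (hasStrictFDerivAt_pi'.mpr (Fin.forall_fin_succ.mpr
      ⟨HasStrictFDerivAt.fun_sum fun j _ => hasStrictFDerivAt_ratio a d (hy j).2,
        Fin.forall_fin_two.mpr
          ⟨HasStrictFDerivAt.fun_sum fun j _ => hasStrictFDerivAt_ratio b d (hy j).2,
            HasStrictFDerivAt.finsetProd fun j _ => hasStrictFDerivAt_ratio c d (hy j).2⟩⟩)) ?_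
  · ext i
    fin_cases i <;> simp [specialize_sumX, specialize_prodX]
  · have h1 := fun j => (hy j).1
    have h2 := fun j => (hy j).2
    refine surjective_of_scaled_det_ne_zero hdet (ρ := ![1, 1, ∏ j, ratio c d (y j)])
      (s := fun j => (aeval (y j) d ^ 2 * aeval (y j) c)⁻¹) (fun i => ?_)
      (fun j => inv_ne_zero (mul_ne_zero (pow_ne_zero 2 (hy j).2) (hy j).1)) fun v i => ?_
    · have : ∏ j, ratio c d (y j) ≠ 0 :=
        Finset.prod_ne_zero_iff.mpr fun j _ => div_ne_zero (h1 j) (h2 j)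
      fin_cases i <;> simp [this]
    · fin_cases i
      · simp [Fin.sum_univ_three]
        field_simp [h1, h2]
        ring
      · simp [Fin.sum_univ_three]
        field_simp [h1, h2]
        ring
      · change (∑ j, (∏ l ∈ Finset.univ.erase j, ratio c d (y l)) •
          (aeval (y j) (wronskian d c) / aeval (y j) d ^ 2) •
            ContinuousLinearMap.proj (R := ℝ) (φ := fun _ : Fin 3 => ℝ) j) v =
          (∏ j, ratio c d (y j)) * ∑ j, aeval (y j) (wronskian d c * d) * _
        rw [sum_apply, Finset.mul_sum]
        refine Finset.sum_congr rfl fun j _ => ?_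
        rw [← Finset.mul_prod_erase Finset.univ _ (Finset.mem_univ j)]
        simp only [smul_apply, ContinuousLinearMap.proj_apply, smul_eq_mul, ratio, map_mul]
        field_simp [h1, h2]

end IsCornerData

lemma card_le_mul_of_fibers {α β γ : Type*} {s : Finset α} {t : Finset β} {n : ℕ} (f : α → β)
    (g : α → γ) (W : β → Finset γ) (hf : ∀ x ∈ s, f x ∈ t) (hg : ∀ x ∈ s, g x ∈ W (f x))
    (hW : ∀ z ∈ t, (W z).card ≤ n)
    (hinj : ∀ x ∈ s, ∀ y ∈ s, f x = f y → g x = g y → x = y) : s.card ≤ n * t.card := by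
  classical
  calc s.card ≤ (t.sigma W).card :=
        Finset.card_le_card_of_injOn (fun x => ⟨f x, g x⟩)
          (fun x hx => Finset.mem_coe.mpr (Finset.mem_sigma.mpr ⟨hf x hx, hg x hx⟩))
          fun x hx y hy hxy => by
            simp only [Sigma.mk.injEq, heq_eq_eq] at hxy
            exact hinj x hx y hy hxy.1 hxy.2
    _ = ∑ z ∈ t, (W z).card := Finset.card_sigma _ _
    _ ≤ n * t.card := by
        rw [mul_comm]
        exact Finset.sum_le_card_nsmul _ _ _ hW

section Counting

variable {k : Type*} [Field k] [Fintype k] [DecidableEq k] {X : Finset k} {A B C : k → k} {K : ℕ}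

lemma card_triples_le (hA : ∀ u, {y ∈ X | A y = u}.card ≤ K) {Bad : Finset (Fin 2 → k)}
    (hgood : ∀ g ∉ Bad, (Finset.univ.filter fun y : Fin 2 → k =>
      (∀ i, y i ∈ X) ∧ ![∑ i, A (y i), ∑ i, B (y i)] = g).card ≤ K)
    (hbad : (Finset.univ.filter fun y : Fin 2 → k =>
      (∀ i, y i ∈ X) ∧ ![∑ i, A (y i), ∑ i, B (y i)] ∈ Bad).card ≤ K * Fintype.card k) (u v : k) :
    (Finset.univ.filter fun y : Fin 3 → k =>
      (∀ i, y i ∈ X) ∧ ∑ i, A (y i) = u ∧ ∑ i, B (y i) = v).card ≤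
        (K + K * K) * Fintype.card k := by
  set s := Finset.univ.filter fun y : Fin 3 → k =>
      (∀ i, y i ∈ X) ∧ ∑ i, A (y i) = u ∧ ∑ i, B (y i) = v
  rw [← Finset.card_filter_add_card_filter_not (s := s)
    fun y => ![u - A (y 2), v - B (y 2)] ∉ Bad, add_mul]
  refine Nat.add_le_add ?_ ?_
  · refine (card_le_mul_of_fibers (t := Finset.univ.filter fun z => ![u - A z, v - B z] ∉ Bad)
      (fun y => y 2) (fun y => ![y 0, y 1])
      (fun z => Finset.univ.filter fun y : Fin 2 → k =>
        (∀ i, y i ∈ X) ∧ ![∑ i, A (y i), ∑ i, B (y i)] = ![u - A z, v - B z]) ?_ ?_ ?_ ?_).trans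
      (Nat.mul_le_mul_left K (Finset.card_le_univ _))
    · intro y hy
      simpa using (Finset.mem_filter.mp hy).2
    · intro y hy
      simp only [s, Finset.mem_filter, Finset.mem_univ, true_and, Fin.sum_univ_three,
        Fin.forall_fin_succ] at hy
      obtain ⟨⟨hX, rfl, rfl⟩, -⟩ := hy
      simp [Fin.forall_fin_two, Fin.sum_univ_two]
      simp at hX
      tauto
    · intro z hz
      exact hgood _ (Finset.mem_filter.mp hz).2
    · intro y _ z _ h1 h2
      have e0 := congrFun h2 0
      have e1 := congrFun h2 1
      ext i
      fin_cases i
      exacts [e0, e1, h1]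
  · refine (card_le_mul_of_fibers (t := Finset.univ.filter fun y : Fin 2 → k =>
        (∀ i, y i ∈ X) ∧ ![∑ i, A (y i), ∑ i, B (y i)] ∈ Bad)
      (fun y => ![y 0, y 1]) (fun y => y 2)
      (fun z => {y ∈ X | A y = u - ∑ i, A (z i)}) ?_ ?_ ?_ ?_).trans
      ((Nat.mul_le_mul_left K hbad).trans_eq (mul_assoc _ _ _).symm)
    · intro y hy
      simp only [s, Finset.mem_filter, Finset.mem_univ, true_and, Fin.sum_univ_three,
        Fin.forall_fin_succ, not_not] at hy
      obtain ⟨⟨hX, rfl, rfl⟩, hy⟩ := hy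
      simp [Fin.forall_fin_two, Fin.sum_univ_two]
      simp at hX hy
      tauto
    · intro y hy
      simp only [s, Finset.mem_filter, Finset.mem_univ, true_and, Fin.sum_univ_three,
        Fin.forall_fin_succ, not_not] at hy
      obtain ⟨⟨hX, rfl, rfl⟩, hy⟩ := hy
      simp at hX
      simp [Fin.sum_univ_two, hX]
    · exact fun z _ => hA _
    · intro y _ z _ h1 h2
      have e0 := congrFun h1 0
      have e1 := congrFun h1 1
      ext i
      fin_cases i
      exacts [e0, e1, h2]

/-- The octuples of points of `X` satisfying the two linear equations and the multiplicative
equation. -/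
def octuples (X : Finset k) (A B C : k → k) : Finset (Fin 8 → k) :=
  Finset.univ.filter fun y => (∀ i, y i ∈ X) ∧
    A (y 0) - A (y 1) - A (y 2) + A (y 3) - A (y 4) + A (y 5) + A (y 6) - A (y 7) = 0 ∧
    B (y 0) - B (y 1) - B (y 2) + B (y 3) - B (y 4) + B (y 5) + B (y 6) - B (y 7) = 0 ∧
    C (y 0) * C (y 3) * C (y 5) * C (y 6) - C (y 1) * C (y 2) * C (y 4) * C (y 7) = 0

lemma card_octuples_good_le {Bad : Finset (Fin 3 → k)}
    (hgood : ∀ g ∉ Bad, (Finset.univ.filter fun y : Fin 3 → k =>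
      (∀ i, y i ∈ X) ∧ ![∑ i, A (y i), ∑ i, B (y i), ∏ i, C (y i)] = g).card ≤ K) :
    {y ∈ octuples X A B C | C (y 6) ≠ 0 ∧ ![A (y 0) + A (y 3) + A (y 5),
      B (y 0) + B (y 3) + B (y 5), C (y 0) * C (y 3) * C (y 5)] ∉ Bad}.card ≤
        K * Fintype.card k ^ 5 := by
  set τ : (Fin 5 → k) → Fin 3 → k := fun z =>
    ![A (z 0) + A (z 1) + A (z 2) + A (z 3) - A (z 4),
      B (z 0) + B (z 1) + B (z 2) + B (z 3) - B (z 4),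
      C (z 0) * C (z 1) * C (z 2) * C (z 3) / C (z 4)] with hτ
  have key : ∀ y ∈ octuples X A B C, C (y 6) ≠ 0 → ![A (y 0) + A (y 3) + A (y 5),
      B (y 0) + B (y 3) + B (y 5), C (y 0) * C (y 3) * C (y 5)] =
      τ ![y 1, y 2, y 4, y 7, y 6] := by
    intro y hy h6
    obtain ⟨-, h1, h2, h3⟩ := (Finset.mem_filter.mp hy).2
    ext i
    fin_cases i
    · change _ = A (y 1) + A (y 2) + A (y 4) + A (y 7) - A (y 6)
      simp only [Fin.zero_eta, Matrix.cons_val_zero]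
      linear_combination h1
    · change _ = B (y 1) + B (y 2) + B (y 4) + B (y 7) - B (y 6)
      change B (y 0) + B (y 3) + B (y 5) = _
      linear_combination h2
    · change C (y 0) * C (y 3) * C (y 5) = C (y 1) * C (y 2) * C (y 4) * C (y 7) / C (y 6)
      rw [eq_div_iff h6]
      linear_combination h3
  refine (card_le_mul_of_fibers (t := Finset.univ.filter fun z => τ z ∉ Bad)
      (fun y => ![y 1, y 2, y 4, y 7, y 6]) (fun y => ![y 0, y 3, y 5])
      (fun z => Finset.univ.filter fun y : Fin 3 → k =>
        (∀ i, y i ∈ X) ∧ ![∑ i, A (y i), ∑ i, B (y i), ∏ i, C (y i)] = τ z) ?_ ?_ ?_ ?_).trans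
      (Nat.mul_le_mul_left K ((Finset.card_le_univ _).trans_eq (by simp)))
  · intro y hy
    obtain ⟨hy, h6, hb⟩ := Finset.mem_filter.mp hy
    rw [key y hy h6] at hb
    simpa using hb
  · intro y hy
    obtain ⟨hy, h6, -⟩ := Finset.mem_filter.mp hy
    have hX := (Finset.mem_filter.mp hy).2.1
    rw [Finset.mem_filter, ← key y hy h6]
    simp [Fin.forall_fin_succ, Fin.sum_univ_three, Fin.prod_univ_three, hX]
  · intro z hz
    exact hgood _ (Finset.mem_filter.mp hz).2
  · intro y _ z _ h1 h2
    ext i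
    fin_cases i
    exacts [congrFun h2 0, congrFun h1 0, congrFun h1 1, congrFun h2 1, congrFun h1 2,
      congrFun h2 2, congrFun h1 4, congrFun h1 3]

lemma card_octuples_bad_le {Bad : Finset (Fin 3 → k)} {M : ℕ}
    (hbad : (Finset.univ.filter fun y : Fin 3 → k => (∀ i, y i ∈ X) ∧
      ![∑ i, A (y i), ∑ i, B (y i), ∏ i, C (y i)] ∈ Bad).card ≤ K * Fintype.card k ^ 2)
    (hM : ∀ u v, (Finset.univ.filter fun y : Fin 3 → k =>
      (∀ i, y i ∈ X) ∧ ∑ i, A (y i) = u ∧ ∑ i, B (y i) = v).card ≤ M * Fintype.card k) :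
    {y ∈ octuples X A B C | ![A (y 0) + A (y 3) + A (y 5),
      B (y 0) + B (y 3) + B (y 5), C (y 0) * C (y 3) * C (y 5)] ∈ Bad}.card ≤
        M * K * Fintype.card k ^ 5 := by
  have h := card_le_mul_of_fibers (n := M * Fintype.card k)
      (s := {y ∈ octuples X A B C | ![A (y 0) + A (y 3) + A (y 5),
        B (y 0) + B (y 3) + B (y 5), C (y 0) * C (y 3) * C (y 5)] ∈ Bad})
      (t := (Finset.univ.filter fun y : Fin 3 → k => (∀ i, y i ∈ X) ∧
        ![∑ i, A (y i), ∑ i, B (y i), ∏ i, C (y i)] ∈ Bad) ×ˢ (Finset.univ : Finset (Fin 2 → k)))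
      (fun y => (![y 0, y 3, y 5], ![y 6, y 7])) (fun y => ![y 1, y 2, y 4])
      (fun z => Finset.univ.filter fun y : Fin 3 → k =>
        (∀ i, y i ∈ X) ∧ ∑ i, A (y i) = ∑ i, A (z.1 i) + A (z.2 0) - A (z.2 1) ∧
          ∑ i, B (y i) = ∑ i, B (z.1 i) + B (z.2 0) - B (z.2 1)) ?_ ?_ (fun z _ => hM _ _) ?_
  · refine h.trans ?_
    rw [Finset.card_product]
    refine (Nat.mul_le_mul_left _ (Nat.mul_le_mul_right _ hbad)).trans_eq ?_
    simp only [Finset.card_univ, Fintype.card_fun, Fintype.card_fin]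
    ring
  · intro y hy
    obtain ⟨hy, hb⟩ := Finset.mem_filter.mp hy
    have hX := (Finset.mem_filter.mp hy).2.1
    simp [Fin.forall_fin_succ, Fin.sum_univ_three, Fin.prod_univ_three, hX, hb]
  · intro y hy
    obtain ⟨hy, hb⟩ := Finset.mem_filter.mp hy
    obtain ⟨hX, h1, h2, -⟩ := (Finset.mem_filter.mp hy).2
    simp [Fin.forall_fin_succ, Fin.sum_univ_three, hX]
    constructor
    · linear_combination -h1
    · linear_combination -h2
  · intro y _ z _ h1 h2
    obtain ⟨h1, h3⟩ := Prod.mk.inj h1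
    ext i
    fin_cases i
    exacts [congrFun h1 0, congrFun h2 0, congrFun h2 1, congrFun h1 1, congrFun h2 2,
      congrFun h1 2, congrFun h3 0, congrFun h3 1]

lemma card_octuples_zero_le (hA : ∀ u, {y ∈ X | A y = u}.card ≤ K)
    (hC : {y ∈ X | C y = 0}.card ≤ K) {j : Fin 7} (hj : j ≠ 5) :
    {y ∈ octuples X A B C | C (y 6) = 0 ∧ C (y j.succ) = 0}.card ≤
        K * K * K * Fintype.card k ^ 5 := by
  have h := card_le_mul_of_fibers (n := K)
      (s := {y ∈ octuples X A B C | C (y 6) = 0 ∧ C (y j.succ) = 0})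
      (t := Fintype.piFinset fun i : Fin 7 =>
        if i = 5 ∨ i = j then {y ∈ X | C y = 0} else Finset.univ)
      Fin.tail (fun y => y 0)
      (fun z => {y ∈ X | A y = A (z 0) + A (z 1) - A (z 2) + A (z 3) - A (z 4) - A (z 5) + A (z 6)})
      ?_ ?_ (fun z _ => hA _) ?_
  · refine h.trans ?_
    rw [Fintype.card_piFinset, mul_assoc, mul_assoc]
    refine Nat.mul_le_mul_left _ ?_
    calc _ ≤ ∏ i : Fin 7, if i = 5 ∨ i = j then K else Fintype.card k := by
            refine Finset.prod_le_prod' fun i _ => ?_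
            split_ifs
            exacts [hC, le_rfl]
      _ = K * (K * Fintype.card k ^ 5) := by
            fin_cases j <;> simp [Fin.prod_univ_succ, -mul_eq_mul_left_iff] at hj ⊢ <;> ring
  · intro y hy
    obtain ⟨hy, h6, hb⟩ := Finset.mem_filter.mp hy
    have hX := (Finset.mem_filter.mp hy).2.1
    refine Fintype.mem_piFinset.mpr fun i => ?_
    split_ifs with hi
    · rcases hi with rfl | rfl
      · exact Finset.mem_filter.mpr ⟨hX _, h6⟩
      · exact Finset.mem_filter.mpr ⟨hX _, hb⟩
    · exact Finset.mem_univ _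
  · intro y hy
    obtain ⟨hX, h1, -⟩ := (Finset.mem_filter.mp (Finset.mem_filter.mp hy).1).2
    refine Finset.mem_filter.mpr ⟨hX 0, ?_⟩
    change _ = A (y 1) + A (y 2) - A (y 3) + A (y 4) - A (y 5) - A (y 6) + A (y 7)
    linear_combination h1
  · intro y _ z _ h1 h2
    rw [← Fin.cons_self_tail y, ← Fin.cons_self_tail z, h1, h2]

lemma card_octuples_le (hA : ∀ u, {y ∈ X | A y = u}.card ≤ K) (hC : {y ∈ X | C y = 0}.card ≤ K)
    {Bad₂ : Finset (Fin 2 → k)}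
    (hgood₂ : ∀ g ∉ Bad₂, (Finset.univ.filter fun y : Fin 2 → k =>
      (∀ i, y i ∈ X) ∧ ![∑ i, A (y i), ∑ i, B (y i)] = g).card ≤ K)
    (hbad₂ : (Finset.univ.filter fun y : Fin 2 → k =>
      (∀ i, y i ∈ X) ∧ ![∑ i, A (y i), ∑ i, B (y i)] ∈ Bad₂).card ≤ K * Fintype.card k)
    {Bad₃ : Finset (Fin 3 → k)}
    (hgood₃ : ∀ g ∉ Bad₃, (Finset.univ.filter fun y : Fin 3 → k =>
      (∀ i, y i ∈ X) ∧ ![∑ i, A (y i), ∑ i, B (y i), ∏ i, C (y i)] = g).card ≤ K)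
    (hbad₃ : (Finset.univ.filter fun y : Fin 3 → k => (∀ i, y i ∈ X) ∧
      ![∑ i, A (y i), ∑ i, B (y i), ∏ i, C (y i)] ∈ Bad₃).card ≤ K * Fintype.card k ^ 2) :
    (octuples X A B C).card ≤ (K + (K + K * K) * K + 4 * (K * K * K)) * Fintype.card k ^ 5 := by
  set Z := fun j : Fin 7 => {y ∈ octuples X A B C | C (y 6) = 0 ∧ C (y j.succ) = 0}
  have hZ := fun (j : Fin 7) (hj : j ≠ 5) =>
    card_octuples_zero_le (B := B) hA hC hj
  have hsub : octuples X A B C ⊆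
      {y ∈ octuples X A B C | C (y 6) ≠ 0 ∧ ![A (y 0) + A (y 3) + A (y 5),
        B (y 0) + B (y 3) + B (y 5), C (y 0) * C (y 3) * C (y 5)] ∉ Bad₃} ∪
      {y ∈ octuples X A B C | ![A (y 0) + A (y 3) + A (y 5),
        B (y 0) + B (y 3) + B (y 5), C (y 0) * C (y 3) * C (y 5)] ∈ Bad₃} ∪
      ({0, 1, 3, 6} : Finset (Fin 7)).biUnion Z := by
    intro y hy
    by_cases hb : ![A (y 0) + A (y 3) + A (y 5),
        B (y 0) + B (y 3) + B (y 5), C (y 0) * C (y 3) * C (y 5)] ∈ Bad₃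
    · exact Finset.mem_union_left _ (Finset.mem_union_right _ (Finset.mem_filter.mpr ⟨hy, hb⟩))
    by_cases h6 : C (y 6) = 0
    · refine Finset.mem_union_right _ (Finset.mem_biUnion.mpr ?_)
      have h := (Finset.mem_filter.mp hy).2.2.2.2
      rw [h6, mul_zero, zero_sub, neg_eq_zero, mul_eq_zero, mul_eq_zero, mul_eq_zero] at h
      simp only [Z, Finset.mem_filter, hy, h6, true_and]
      rcases h with ((h | h) | h) | h
      exacts [⟨0, by simp, h⟩, ⟨1, by simp, h⟩, ⟨3, by simp, h⟩, ⟨6, by simp, h⟩]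
    · exact Finset.mem_union_left _ (Finset.mem_union_left _ (Finset.mem_filter.mpr ⟨hy, h6, hb⟩))
  refine (Finset.card_le_card hsub).trans ((Finset.card_union_le _ _).trans ?_)
  rw [add_mul]
  refine Nat.add_le_add ((Finset.card_union_le _ _).trans ?_) ?_
  · rw [add_mul]
    exact Nat.add_le_add (card_octuples_good_le hgood₃)
      (card_octuples_bad_le hbad₃ (card_triples_le hA hgood₂ hbad₂))
  · rw [mul_assoc]
    exact Finset.card_biUnion_le_card_mul ({0, 1, 3, 6} : Finset (Fin 7)) Z _ fun j hj =>
      hZ j (by rintro rfl; simp at hj)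

end Counting

lemma card_filter_eval_eq_zero_le {k : Type*} [Field k] [Fintype k] [DecidableEq k] {f : k[X]}
    (hf : f ≠ 0) : (Finset.univ.filter fun y => f.eval y = 0).card ≤ f.natDegree := by
  refine le_trans (Finset.card_le_card fun y hy => ?_)
    ((Multiset.toFinset_card_le f.roots).trans (card_roots' f))
  simpa [hf] using hy

lemma exists_bound_polynomial_map_ne_zero {f : ℤ[X]} (hf : f ≠ 0) :
    ∃ N : ℕ, ∀ p : ℕ, N < p → f.map (Int.castRingHom (ZMod p)) ≠ 0 := by
  refine ⟨f.leadingCoeff.natAbs, fun p hp h => ?_⟩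
  have h1 := congrArg (fun g => coeff g f.natDegree) h
  simp only [coeff_map, coeff_zero, eq_intCast, ZMod.intCast_zmod_eq_zero_iff_dvd] at h1
  exact leadingCoeff_ne_zero.mpr hf
    (Int.eq_zero_of_dvd_of_natAbs_lt_natAbs h1 (by simpa using hp))

lemma eval_map_intCast {k : Type*} [Field k] (f : ℤ[X]) (y : k) :
    (f.map (Int.castRingHom k)).eval y = aeval y f := by
  rw [eval_map, aeval_def]
  rfl

lemma card_ratio_fiber_le {p : ℕ} [Fact p.Prime] {a d : ℤ[X]}
    (h : (wronskian d a).map (Int.castRingHom (ZMod p)) ≠ 0) (u : ZMod p) :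
    (Finset.univ.filter fun y : ZMod p => aeval y d ≠ 0 ∧ ratio a d y = u).card ≤
      max a.natDegree d.natDegree := by
  set f := a.map (Int.castRingHom (ZMod p)) - Polynomial.C u * d.map (Int.castRingHom (ZMod p))
    with hf
  have hf0 : f ≠ 0 := by
    intro h0
    rw [hf, sub_eq_zero] at h0
    refine h ?_
    rw [map_wronskian, h0, wronskian]
    simp only [derivative_mul, derivative_C]
    ring
  refine (Finset.card_le_card fun y hy => ?_).trans ((card_filter_eval_eq_zero_le hf0).trans
    ((natDegree_sub_le _ _).trans
      (max_le_max (natDegree_map_le) ((natDegree_C_mul_le _ _).trans (natDegree_map_le)))))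
  obtain ⟨-, hd, hy⟩ := Finset.mem_filter.mp hy
  refine Finset.mem_filter.mpr ⟨Finset.mem_univ _, ?_⟩
  rw [hf, eval_sub, eval_mul, eval_C, eval_map_intCast, eval_map_intCast, sub_eq_zero, ← hy, ratio,
    div_mul_cancel₀ _ hd]

lemma card_ratio_eq_zero_le {p : ℕ} [Fact p.Prime] {c d : ℤ[X]}
    (h : c.map (Int.castRingHom (ZMod p)) ≠ 0) :
    (Finset.univ.filter fun y : ZMod p => aeval y d ≠ 0 ∧ ratio c d y = 0).card ≤
      c.natDegree := by
  refine (Finset.card_le_card fun y hy => ?_).trans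
    ((card_filter_eval_eq_zero_le h).trans natDegree_map_le)
  obtain ⟨-, hd, hy⟩ := Finset.mem_filter.mp hy
  refine Finset.mem_filter.mpr ⟨Finset.mem_univ _, ?_⟩
  rw [eval_map_intCast]
  exact (div_eq_zero_iff.mp hy).resolve_right hd

lemma exists_fiber_bound_prodX {n : ℕ} (hn : 0 < n) {d : ℤ[X]} (hd : d ≠ 0)
    {F : Fin n → Localization.Away (prodX n d)} (hF : AlgebraicIndependent ℤ F)
    (G : ∀ {p : ℕ} [Fact p.Prime], (Fin n → ZMod p) → Fin n → ZMod p)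
    (hG : ∀ {p : ℕ} [Fact p.Prime] (y : Fin n → ZMod p)
      (h : MvPolynomial.aeval y (prodX n d) ≠ 0), (fun i => specialize _ y h (F i)) = G y) :
    ∃ K : ℕ, ∀ p : ℕ, [Fact p.Prime] → K < p → ∃ Bad : Finset (Fin n → ZMod p),
      (∀ g ∉ Bad, (Finset.univ.filter fun y : Fin n → ZMod p =>
        (∀ i, y i ∈ Finset.univ.filter fun z : ZMod p => aeval z d ≠ 0) ∧ G y = g).card ≤ K) ∧
      (Finset.univ.filter fun y : Fin n → ZMod p =>
        (∀ i, y i ∈ Finset.univ.filter fun z : ZMod p => aeval z d ≠ 0) ∧ G y ∈ Bad).card ≤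
          K * p ^ (n - 1) := by
  obtain ⟨K, hK⟩ := exists_fiber_bound hn (prodX_ne_zero n hd) hF
  refine ⟨K, fun p _ hp => ?_⟩
  obtain ⟨Bad, h1, h2⟩ := hK p hp
  have key : ∀ S : Set (Fin n → ZMod p), ∀ s : Finset (Fin n → ZMod p),
      (∀ y ∈ s, (∀ i, aeval (y i) d ≠ 0) ∧ G y ∈ S) →
      s.card ≤ Nat.card {y : Fin n → ZMod p // ∃ h : MvPolynomial.aeval y (prodX n d) ≠ 0,
        (fun i => specialize _ y h (F i)) ∈ S} := by
    intro S s hs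
    rw [← Set.ncard_coe_finset, ← Nat.card_coe_set_eq]
    refine Nat.card_mono (Set.toFinite _) fun y hy => ?_
    obtain ⟨hy, hy'⟩ := hs y hy
    have h := (aeval_prodX_ne_zero d y).mpr hy
    exact ⟨h, (hG y h).symm ▸ hy'⟩
  refine ⟨Bad.toFinite.toFinset, fun g hg => ?_, ?_⟩
  · refine (key {g} _ fun y hy => ?_).trans (h1 g fun h => hg (by simpa using h))
    simpa using hy
  · refine (key Bad _ fun y hy => ?_).trans h2
    simpa using hy

theorem IsCornerData.exists_octuples_bound {a b c d : ℤ[X]} (H : IsCornerData a b c d) :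
    ∃ K : ℕ, ∀ p : ℕ, [Fact p.Prime] → K < p →
      (octuples (Finset.univ.filter fun y : ZMod p => aeval y d ≠ 0)
        (ratio a d) (ratio b d) (ratio c d)).card ≤ K * p ^ 5 := by
  have hW : wronskian d a ≠ 0 := fun h => H.ne_zero_and_linearIndependent.2.ne_zero 0 (by simp [h])
  obtain ⟨K₁, hK₁⟩ := exists_bound_polynomial_map_ne_zero hW
  obtain ⟨K₂, hK₂⟩ := exists_bound_polynomial_map_ne_zero H.ne_zero
  obtain ⟨K₃, hK₃⟩ := exists_fiber_bound_prodX two_pos H.denom_ne_zero H.algebraicIndependent_two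
    (fun y => ![∑ i, ratio a d (y i), ∑ i, ratio b d (y i)]) (fun y h => by
      ext i
      fin_cases i <;> simp [specialize_sumX])
  obtain ⟨K₄, hK₄⟩ := exists_fiber_bound_prodX three_pos H.denom_ne_zero
    H.algebraicIndependent_three
    (fun y => ![∑ i, ratio a d (y i), ∑ i, ratio b d (y i), ∏ i, ratio c d (y i)])
    (fun y h => by
      ext i
      fin_cases i <;> simp [specialize_sumX, specialize_prodX])
  set m := max a.natDegree d.natDegree + c.natDegree + K₃ + K₄ with hm
  refine ⟨K₁ + K₂ + K₃ + K₄ + (m + (m + m * m) * m + 4 * (m * m * m)), fun p _ hp => ?_⟩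
  obtain ⟨Bad₂, h1, h2⟩ := hK₃ p (by lia)
  obtain ⟨Bad₃, h3, h4⟩ := hK₄ p (by lia)
  refine le_trans (card_octuples_le (K := m) (fun u => ?_) ?_ (Bad₂ := Bad₂) (fun g hg => ?_) ?_
    (Bad₃ := Bad₃) (fun g hg => ?_) ?_) ?_
  · rw [Finset.filter_filter]
    exact (card_ratio_fiber_le (hK₁ p (by lia)) u).trans (by lia)
  · rw [Finset.filter_filter]
    exact (card_ratio_eq_zero_le (hK₂ p (by lia))).trans (by lia)
  · exact (h1 g hg).trans (by lia)
  · refine h2.trans ?_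
    rw [ZMod.card, show 2 - 1 = 1 from rfl, pow_one]
    exact Nat.mul_le_mul_right _ (by lia)
  · exact (h3 g hg).trans (by lia)
  · refine h4.trans ?_
    rw [ZMod.card]
    exact Nat.mul_le_mul_right _ (by lia)
  · rw [ZMod.card]
    exact Nat.mul_le_mul_right _ (by lia)

lemma coeff_polyRed (p : ℕ) (f : ℚ[X]) (n : ℕ) :
    (polyRed p f).coeff n = ratRed p (f.coeff n) := by
  rw [polyRed, Polynomial.sum, finsetSum_coeff]
  simp only [coeff_C_mul, coeff_X_pow, mul_ite, mul_one, mul_zero]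
  rw [Finset.sum_ite_eq, ite_eq_left_iff]
  intro h
  rw [notMem_support_iff.mp h, ratRed]
  simp

lemma exists_integer_multiples (f g : ℚ[X]) : ∃ (M : ℤ) (f' g' : ℤ[X]), M ≠ 0 ∧
    f'.map (Int.castRingHom ℚ) = Polynomial.C (M : ℚ) * f ∧
    g'.map (Int.castRingHom ℚ) = Polynomial.C (M : ℚ) * g := by
  obtain ⟨M₁, h₁, e₁⟩ := IsLocalization.integerNormalization_spec (nonZeroDivisors ℤ) f
  obtain ⟨M₂, h₂, e₂⟩ := IsLocalization.integerNormalization_spec (nonZeroDivisors ℤ) g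
  refine ⟨M₁ * M₂, Polynomial.C M₂ * IsLocalization.integerNormalization (nonZeroDivisors ℤ) f,
    Polynomial.C M₁ * IsLocalization.integerNormalization (nonZeroDivisors ℤ) g,
    mul_ne_zero (nonZeroDivisors.ne_zero h₁) (nonZeroDivisors.ne_zero h₂), ?_, ?_⟩
  · rw [algebraMap_int_eq] at e₁
    rw [Polynomial.map_mul, e₁, map_C, zsmul_eq_mul, ← Polynomial.C_eq_intCast]
    simp
    ring
  · rw [algebraMap_int_eq] at e₂
    rw [Polynomial.map_mul, e₂, map_C, zsmul_eq_mul, ← Polynomial.C_eq_intCast]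
    simp
    ring

lemma ratRed_of_intCast_eq {p : ℕ} [Fact p.Prime] {M z : ℤ} {q : ℚ} (h : (z : ℚ) = M * q)
    (hM : (M : ZMod p) ≠ 0) : ratRed p q = (M : ZMod p)⁻¹ * z := by
  have h1 : z * q.den = M * q.num := by
    have h2 : (z : ℚ) * q.den = M * q.num := by
      rw [h, mul_assoc, Rat.mul_den_eq_num]
    exact_mod_cast h2
  have h2 : (q.den : ZMod p) ≠ 0 := by
    intro h3
    have h4 : (q.den : ℤ) ∣ M := by
      refine IsCoprime.dvd_of_dvd_mul_right (z := q.num) ?_ ⟨z, by rw [← h1, mul_comm]⟩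
      exact (Int.isCoprime_iff_gcd_eq_one.mpr (by simpa [Int.gcd] using q.reduced)).symm
    obtain ⟨w, rfl⟩ := h4
    exact hM (by push_cast; rw [h3, zero_mul])
  have h3 : (z : ZMod p) * q.den = M * q.num := by
    exact_mod_cast congrArg (Int.cast : ℤ → ZMod p) h1
  rw [ratRed]
  field_simp
  linear_combination -h3

lemma polyRed_of_map_eq {p : ℕ} [Fact p.Prime] {M : ℤ} {f : ℚ[X]} {f' : ℤ[X]}
    (h : f'.map (Int.castRingHom ℚ) = Polynomial.C (M : ℚ) * f) (hM : (M : ZMod p) ≠ 0) :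
    polyRed p f = Polynomial.C (M : ZMod p)⁻¹ * f'.map (Int.castRingHom (ZMod p)) := by
  ext n
  rw [coeff_polyRed, coeff_C_mul, coeff_map, eq_intCast]
  refine ratRed_of_intCast_eq ?_ hM
  have := congrArg (fun g => coeff g n) h
  simpa using this

lemma exists_ratio_eq_evalRed (P : RatFunc ℚ) : ∃ (N : ℕ) (n d : ℤ[X]), d ≠ 0 ∧
    P * algebraMap ℚ[X] (RatFunc ℚ) (d.map (Int.castRingHom ℚ)) =
      algebraMap ℚ[X] (RatFunc ℚ) (n.map (Int.castRingHom ℚ)) ∧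
    ∀ p : ℕ, [Fact p.Prime] → N < p → ∀ y : ZMod p, ¬ IsPole p P y →
      aeval y d ≠ 0 ∧ evalRed p P y = ratio n d y := by
  obtain ⟨M, n, d, hM, hn, hd⟩ := exists_integer_multiples P.num P.denom
  refine ⟨M.natAbs, n, d, ?_, ?_, fun p _ hp y hy => ?_⟩
  · rintro rfl
    rw [Polynomial.map_zero, eq_comm, mul_eq_zero, C_eq_zero] at hd
    exact hd.elim (by exact_mod_cast hM) P.denom_ne_zero
  · rw [hn, hd, map_mul, map_mul]
    nth_rw 1 [← P.num_div_denom]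
    have := RatFunc.algebraMap_ne_zero P.denom_ne_zero
    field_simp
  · have hM' : (M : ZMod p) ≠ 0 := by
      rw [Ne, ZMod.intCast_zmod_eq_zero_iff_dvd]
      exact fun h => hM (Int.eq_zero_of_dvd_of_natAbs_lt_natAbs h (by simpa using hp))
    rw [IsPole, polyRed_of_map_eq hd hM', eval_mul, eval_C, eval_map_intCast] at hy
    have hd0 : aeval y d ≠ 0 := right_ne_zero_of_mul hy
    refine ⟨hd0, ?_⟩
    rw [evalRed, polyRed_of_map_eq hd hM', polyRed_of_map_eq hn hM', eval_mul, eval_mul, eval_C,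
      eval_map_intCast, eval_map_intCast, ratio]
    field_simp

lemma ratDeriv_mul_sq {P : RatFunc ℚ} {n d : ℚ[X]}
    (h : P * algebraMap ℚ[X] (RatFunc ℚ) d = algebraMap ℚ[X] (RatFunc ℚ) n) :
    ratDeriv P * algebraMap ℚ[X] (RatFunc ℚ) d ^ 2 =
      algebraMap ℚ[X] (RatFunc ℚ) (wronskian d n) := by
  have hD := RatFunc.algebraMap_ne_zero P.denom_ne_zero
  have e : n * P.denom = P.num * d := by
    apply RatFunc.algebraMap_injective ℚ
    rw [map_mul, map_mul, ← h]
    nth_rw 1 [← P.num_div_denom]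
    field_simp
  have e' := congrArg derivative e
  simp only [derivative_mul] at e'
  have hfrac : (derivative P.num * P.denom - P.num * derivative P.denom) * d ^ 2 =
      wronskian d n * P.denom ^ 2 := by
    rw [wronskian]
    linear_combination (d * derivative P.denom + derivative d * P.denom) * e - d * P.denom * e'
  rw [ratDeriv, div_mul_eq_mul_div, div_eq_iff (RatFunc.algebraMap_ne_zero
    (pow_ne_zero 2 P.denom_ne_zero)), ← map_pow, ← map_mul, ← map_mul, hfrac]

lemma linearIndependent_of_mul_eq {P Q : RatFunc ℚ}
    (hPQ : LinearIndependent ℚ ![P, Q, (1 : RatFunc ℚ)]) {a b d : ℚ[X]} (hd : d ≠ 0)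
    (ha : P * algebraMap ℚ[X] (RatFunc ℚ) d = algebraMap ℚ[X] (RatFunc ℚ) a)
    (hb : Q * algebraMap ℚ[X] (RatFunc ℚ) d = algebraMap ℚ[X] (RatFunc ℚ) b) :
    LinearIndependent ℚ ![a, b, d] := by
  rw [Fintype.linearIndependent_iff] at hPQ ⊢
  intro g hg
  refine hPQ g ?_
  have h := congrArg (algebraMap ℚ[X] (RatFunc ℚ)) hg
  rw [map_zero] at h
  have hd' := RatFunc.algebraMap_ne_zero hd
  refine (mul_eq_zero.mp (?_ : _ * algebraMap ℚ[X] (RatFunc ℚ) d = 0)).resolve_right hd'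
  rw [← h]
  simp only [Fin.sum_univ_three, Matrix.cons_val, map_add, add_mul, smul_mul_assoc, ha, hb, one_mul,
    map_rat_smul]

lemma exists_isCornerData {P Q R : RatFunc ℚ}
    (hPQ : LinearIndependent ℚ ![P, Q, (1 : RatFunc ℚ)]) (hR : R = ratDeriv P / ratDeriv Q) :
    ∃ (N : ℕ) (a b c d : ℤ[X]), IsCornerData a b c d ∧
      ∀ p : ℕ, [Fact p.Prime] → N < p → ∀ y : ZMod p, ¬ IsPole p P y → ¬ IsPole p Q y →
        ¬ IsPole p R y → aeval y d ≠ 0 ∧ evalRed p P y = ratio a d y ∧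
          evalRed p Q y = ratio b d y ∧ evalRed p R y = ratio c d y := by
  obtain ⟨N₁, a, d₁, hd₁, ha, h₁⟩ := exists_ratio_eq_evalRed P
  obtain ⟨N₂, b, d₂, hd₂, hb, h₂⟩ := exists_ratio_eq_evalRed Q
  obtain ⟨N₃, c, d₃, hd₃, hc, h₃⟩ := exists_ratio_eq_evalRed R
  have hd : d₁ * d₂ * d₃ ≠ 0 := mul_ne_zero (mul_ne_zero hd₁ hd₂) hd₃
  have hdQ := (Polynomial.map_ne_zero_iff (f := Int.castRingHom ℚ) Int.cast_injective).mpr hd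
  have ha' : P * algebraMap ℚ[X] (RatFunc ℚ) ((d₁ * d₂ * d₃).map (Int.castRingHom ℚ)) =
      algebraMap ℚ[X] (RatFunc ℚ) ((a * d₂ * d₃).map (Int.castRingHom ℚ)) := by
    simp only [Polynomial.map_mul, map_mul, ← ha]
    ring
  have hb' : Q * algebraMap ℚ[X] (RatFunc ℚ) ((d₁ * d₂ * d₃).map (Int.castRingHom ℚ)) =
      algebraMap ℚ[X] (RatFunc ℚ) ((b * d₁ * d₃).map (Int.castRingHom ℚ)) := by
    simp only [Polynomial.map_mul, map_mul, ← hb]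
    ring
  have hc' : R * algebraMap ℚ[X] (RatFunc ℚ) ((d₁ * d₂ * d₃).map (Int.castRingHom ℚ)) =
      algebraMap ℚ[X] (RatFunc ℚ) ((c * d₁ * d₂).map (Int.castRingHom ℚ)) := by
    simp only [Polynomial.map_mul, map_mul, ← hc]
    ring
  have hlin := linearIndependent_of_mul_eq hPQ hdQ ha' hb'
  refine ⟨N₁ + N₂ + N₃, a * d₂ * d₃, b * d₁ * d₃, c * d₁ * d₂, d₁ * d₂ * d₃, ⟨hd, hlin, ?_⟩,
    fun p _ hp y hP hQ hR => ?_⟩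
  · have hP' := ratDeriv_mul_sq ha'
    have hQ' := ratDeriv_mul_sq hb'
    have hQ0 : ratDeriv Q ≠ 0 := by
      intro h0
      rw [h0, zero_mul, eq_comm, map_eq_zero_iff _ (RatFunc.algebraMap_injective ℚ)] at hQ'
      obtain ⟨t, ht⟩ := exists_eq_C_mul_of_wronskian_eq_zero hdQ hQ'
      have := Fintype.linearIndependent_iff.mp hlin ![0, 1, -t] (by
        simp [Fin.sum_univ_three, -Polynomial.map_mul, ht, smul_eq_C_mul]) 1
      simp at this
    apply Polynomial.map_injective (Int.castRingHom ℚ) Int.cast_injective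
    apply RatFunc.algebraMap_injective ℚ
    rw [Polynomial.map_mul (p := c * d₁ * d₂), Polynomial.map_mul (p := wronskian _ _),
      map_wronskian,
      map_wronskian, map_mul, map_mul, ← hP', ← hQ', ← hc', hR]
    field_simp
  · obtain ⟨e₁, f₁⟩ := h₁ p (by lia) y hP
    obtain ⟨e₂, f₂⟩ := h₂ p (by lia) y hQ
    obtain ⟨e₃, f₃⟩ := h₃ p (by lia) y hR
    simp only [f₁, f₂, f₃, ratio, map_mul]
    refine ⟨mul_ne_zero (mul_ne_zero e₁ e₂) e₃, ?_, ?_, ?_⟩ <;> field_simp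

/-- **Steps 2–5 of Theorem 4.2.** Point count `|Z′(F_p)| ≪ p⁵` for the auxiliary variety
`Z′` in the eight variables `(y₁,…,y₈)`, where `R = P′/Q′`. -/
theorem Zprime_count (P Q : RatFunc ℚ)
    (hPQ : LinearIndependent ℚ ![P, Q, (1 : RatFunc ℚ)])
    (R : RatFunc ℚ) (hR : R = ratDeriv P / ratDeriv Q) :
    ∃ C : ℝ, 0 < C ∧ ∀ (p : ℕ) [Fact p.Prime],
      Admissible p P → Admissible p Q → Admissible p R →
      (Nat.card {y : Fin 8 → ZMod p //
          (∀ i, ¬ IsPole p P (y i)) ∧ (∀ i, ¬ IsPole p Q (y i)) ∧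
          (∀ i, ¬ IsPole p R (y i)) ∧
          evalRed p P (y 0) - evalRed p P (y 1) - evalRed p P (y 2) + evalRed p P (y 3) -
              evalRed p P (y 4) + evalRed p P (y 5) + evalRed p P (y 6) -
              evalRed p P (y 7) = 0 ∧
          evalRed p Q (y 0) - evalRed p Q (y 1) - evalRed p Q (y 2) + evalRed p Q (y 3) -
              evalRed p Q (y 4) + evalRed p Q (y 5) + evalRed p Q (y 6) -
              evalRed p Q (y 7) = 0 ∧
          evalRed p R (y 0) * evalRed p R (y 3) * evalRed p R (y 5) * evalRed p R (y 6) -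
              evalRed p R (y 1) * evalRed p R (y 2) * evalRed p R (y 4) *
                evalRed p R (y 7) = 0} : ℝ) ≤
        C * (p : ℝ) ^ 5 := by
  obtain ⟨N, a, b, c, d, H, h⟩ := exists_isCornerData hPQ hR
  obtain ⟨K, hK⟩ := H.exists_octuples_bound
  refine ⟨K + (N + K : ℝ) ^ 3 + 1, by positivity, fun p _ _ _ _ => ?_⟩
  rcases lt_or_ge (N + K) p with hp | hp
  · have hNK : (0 : ℝ) ≤ (N + K : ℝ) ^ 3 := by positivity
    refine le_trans (b := (K : ℝ) * (p : ℝ) ^ 5) ?_ ?_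
    swap
    · gcongr
      linarith
    norm_cast
    refine le_trans ?_ (hK p (by lia))
    rw [← Set.ncard_coe_finset, ← Nat.card_coe_set_eq]
    refine Nat.card_mono (Set.toFinite _) fun y hy => ?_
    obtain ⟨h₁, h₂, h₃, e₁, e₂, e₃⟩ := hy
    have h' := fun i => h p (by lia) (y i) (h₁ i) (h₂ i) (h₃ i)
    simp only [fun i => (h' i).2.1, fun i => (h' i).2.2.1, fun i => (h' i).2.2.2] at e₁ e₂ e₃
    exact Finset.mem_coe.mpr (Finset.mem_filter.mpr ⟨Finset.mem_univ _,
      fun i => Finset.mem_filter.mpr ⟨Finset.mem_univ _, (h' i).1⟩, e₁, e₂, e₃⟩)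
  · refine le_trans (b := ((p : ℝ) ^ 3 * p ^ 5)) ?_ ?_
    · rw [← pow_add]
      norm_cast
      refine (Finite.card_subtype_le _).trans_eq ?_
      simp [Nat.card_eq_fintype_card, ZMod.card]
    · have : (p : ℝ) ≤ N + K := by exact_mod_cast hp
      have := pow_le_pow_left₀ (Nat.cast_nonneg p) this 3
      gcongr
      linarith [(Nat.cast_nonneg K : (0 : ℝ) ≤ K)]

end RatCorners
end
end
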